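/- arXiv:2502.20595 — 10 statements merged into one kernel-verified Lean document; each statement's English description precedes it below -/
import Mathlib

section
/- Suppose D = c₁ B₁ + … + c_n B_n is a ℂ-linear combination of pairwise distinct canonical basis elements B_i = z^{α₁ᵢ} z̄^{β₁ᵢ} ∂^{α₂ᵢ} ∂̄^{β₂ᵢ} of the Weyl algebra A₂, with all c_i ∈ ℂ nonzero. If D commutes with rotations, then every parameter tuple satisfies α₁ᵢ + β₂ᵢ = β₁ᵢ + α₂ᵢ; that is, D lies in the ℂ-linear span of the canonical basis elements z^{α₁} z̄^{β₁} ∂^{α₂} ∂̄^{β₂} with α₁ + β₂ = β₁ + α₂. -/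
open MvPolynomial

noncomputable section

/-- The polynomial ring ℂ[z, z̄]; `X 0` is `z` and `X 1` is `z̄`. -/
abbrev P2 : Type := MvPolynomial (Fin 2) ℂ

/-- Multiplication by `z`. -/
def Mz : Module.End ℂ P2 := LinearMap.mulLeft ℂ (X 0 : P2)
/-- Multiplication by `z̄`. -/
def Mzbar : Module.End ℂ P2 := LinearMap.mulLeft ℂ (X 1 : P2)
/-- Formal `∂/∂z`. -/
def Dz : Module.End ℂ P2 := (pderiv (0 : Fin 2)).toLinearMap
/-- Formal `∂/∂z̄`. -/
def Dzbar : Module.End ℂ P2 := (pderiv (1 : Fin 2)).toLinearMap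

/-- Rotation operator `R_θ : p(z, z̄) ↦ p(e^{iθ} z, e^{-iθ} z̄)`. -/
def rot (θ : ℝ) : Module.End ℂ P2 :=
  (aeval (fun i : Fin 2 => if i = 0 then (Complex.exp (θ * Complex.I)) • (X 0 : P2)
    else (Complex.exp (-(θ * Complex.I))) • (X 1 : P2))).toLinearMap

/-- `D` commutes with rotations: `D ∘ R_θ = R_θ ∘ D` for all `θ ∈ [0, 2π)`. -/
def CommutesWithRotations (D : Module.End ℂ P2) : Prop :=
  ∀ θ : ℝ, 0 ≤ θ → θ < 2 * Real.pi → D * rot θ = rot θ * D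

/-- The second Weyl algebra `A₂`, as a subalgebra of `End ℂ (ℂ[z, z̄])`. -/
def WeylA2 : Subalgebra ℂ (Module.End ℂ P2) :=
  Algebra.adjoin ℂ {Mz, Mzbar, Dz, Dzbar}

/-- Canonical basis element `z^{a1} z̄^{b1} ∂^{a2} ∂̄^{b2}` of `A₂`. -/
def canB (a1 b1 a2 b2 : ℕ) : Module.End ℂ P2 :=
  Mz ^ a1 * Mzbar ^ b1 * Dz ^ a2 * Dzbar ^ b2

open Finsupp in
theorem mulLeft_X_pow_monomial (i : Fin 2) (n : ℕ) (s : Fin 2 →₀ ℕ) (r : ℂ) :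
    (LinearMap.mulLeft ℂ (X i : P2) ^ n) (monomial s r) = monomial (s + single i n) r := by
  rw [LinearMap.pow_mulLeft, LinearMap.mulLeft_apply, X_pow_eq_monomial, monomial_mul, one_mul,
    add_comm]

open Finsupp in
theorem pderiv_pow_monomial (i : Fin 2) (n : ℕ) (s : Fin 2 →₀ ℕ) (r : ℂ) :
    ((pderiv i : Derivation ℂ P2 P2).toLinearMap ^ n) (monomial s r) =
      monomial (s - single i n) (r * ((s i).descFactorial n : ℂ)) := by
  induction n with
  | zero => simp
  | succ n ih =>
    rw [pow_succ', Module.End.mul_apply, ih,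
      Derivation.coeFn_coe, pderiv_monomial, tsub_tsub, ← single_add]
    congr 1
    simp only [tsub_apply, single_eq_same, Nat.descFactorial_succ]
    push_cast
    ring

open Finsupp in
theorem canB_monomial (a1 b1 a2 b2 : ℕ) (s : Fin 2 →₀ ℕ) (r : ℂ) :
    canB a1 b1 a2 b2 (monomial s r) =
      monomial (s - single 1 b2 - single 0 a2 + single 1 b1 + single 0 a1)
        (r * ((s 1).descFactorial b2 : ℂ) * ((s 0).descFactorial a2 : ℂ)) := by
  simp only [canB, Mz, Mzbar, Dz, Dzbar, Module.End.mul_apply, pderiv_pow_monomial,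
    mulLeft_X_pow_monomial]
  simp

theorem rot_monomial (θ : ℝ) (s : Fin 2 →₀ ℕ) (r : ℂ) :
    rot θ (monomial s r) =
      Complex.exp (((s 0 : ℂ) - s 1) * (θ * Complex.I)) • monomial s r := by
  have h : Complex.exp (((s 0 : ℂ) - s 1) * (θ * Complex.I)) =
      Complex.exp (θ * Complex.I) ^ s 0 * Complex.exp (-(θ * Complex.I)) ^ s 1 := by
    rw [← Complex.exp_nat_mul, ← Complex.exp_nat_mul, ← Complex.exp_add]
    congr 1
    ring
  rw [h, rot, AlgHom.toLinearMap_apply, aeval_monomial, monomial_eq,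
    Finsupp.prod_fintype _ _ (by simp), Finsupp.prod_fintype _ _ (by simp)]
  simp only [Fin.prod_univ_two, mul_pow, algebraMap_eq, smul_eq_C_mul, if_true, one_ne_zero,
    if_false, map_mul, map_pow]
  ring

theorem coeff_rot (θ : ℝ) (s : Fin 2 →₀ ℕ) (p : P2) :
    coeff s (rot θ p) = Complex.exp (((s 0 : ℂ) - s 1) * (θ * Complex.I)) * coeff s p := by
  induction p using MvPolynomial.induction_on' with
  | monomial t r =>
    rw [rot_monomial, coeff_smul, smul_eq_mul, coeff_monomial]
    split_ifs with h
    · rw [h]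
    · simp
  | add p q hp hq => rw [map_add, coeff_add, coeff_add, hp, hq, mul_add]

/-- A rotation-commuting operator preserves the weight `s 0 - s 1` of monomials. -/
theorem CommutesWithRotations.coeff_monomial_eq_zero {D : Module.End ℂ P2}
    (hD : CommutesWithRotations D) {s t : Fin 2 →₀ ℕ} (r : ℂ)
    (hst : s 0 + t 1 ≠ t 0 + s 1) : coeff t (D (monomial s r)) = 0 := by
  set N : ℝ := (s 0 : ℝ) + t 1 - (t 0 + s 1) with hN
  have hN0 : N ≠ 0 := sub_ne_zero.mpr (by exact_mod_cast hst)
  have hN1 : 1 ≤ |N| := by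
    have h : (1 : ℤ) ≤ |(s 0 : ℤ) + t 1 - (t 0 + s 1)| := Int.one_le_abs (by omega)
    rw [hN]
    exact_mod_cast h
  have hpos := Real.pi_pos
  have key := congrArg (fun E : Module.End ℂ P2 => coeff t (E (monomial s r)))
    (hD (Real.pi / |N|) (by positivity)
      ((div_le_self hpos.le hN1).trans_lt (by linarith)))
  simp only [Module.End.mul_apply, rot_monomial, map_smul, coeff_smul, coeff_rot,
    smul_eq_mul] at key
  by_contra hne
  have hexp := mul_right_cancel₀ hne key
  have hcast : ((s 0 : ℂ) - s 1) - (t 0 - t 1) = (N : ℂ) := by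
    rw [hN]
    push_cast
    ring
  have hone : Complex.exp ((N : ℂ) * ((Real.pi / |N| : ℝ) * Complex.I)) = 1 := by
    rw [← hcast, sub_mul, Complex.exp_sub, hexp, div_self (Complex.exp_ne_zero _)]
  have hneg : Complex.exp ((N : ℂ) * ((Real.pi / |N| : ℝ) * Complex.I)) = -1 := by
    rw [← mul_assoc, ← Complex.ofReal_mul]
    rcases abs_choice N with h | h <;> rw [h]
    · rw [mul_div_cancel₀ _ hN0, Complex.exp_pi_mul_I]
    · rw [div_neg, mul_neg, mul_div_cancel₀ _ hN0, Complex.ofReal_neg, neg_mul,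
        Complex.exp_neg, Complex.exp_pi_mul_I]
      norm_num
  rw [hone] at hneg
  norm_num at hneg

/-- if a ℂ-linear combination of pairwise distinct canonical basis
elements with nonzero coefficients commutes with rotations, then every
parameter tuple satisfies `α₁ + β₂ = β₁ + α₂`. -/
theorem params_of_commutesWithRotations (n : ℕ) (c : Fin n → ℂ)
    (prm : Fin n → ℕ × ℕ × ℕ × ℕ) (hinj : Function.Injective prm)
    (hc : ∀ i, c i ≠ 0) (D : Module.End ℂ P2)
    (hD : D = ∑ i, c i • canB (prm i).1 (prm i).2.1 (prm i).2.2.1 (prm i).2.2.2)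
    (hcomm : CommutesWithRotations D) :
    ∀ i, (prm i).1 + (prm i).2.2.2 = (prm i).2.1 + (prm i).2.2.1 := by
  by_contra! hbad
  obtain ⟨i, hi, hmin⟩ := (Set.toFinite {i | (prm i).1 + (prm i).2.2.2 ≠
    (prm i).2.1 + (prm i).2.2.1}).exists_minimalFor
      (fun i => (prm i).2.2.1 + (prm i).2.2.2) _ hbad
  simp only [Set.mem_ofPred_eq] at hi hmin
  let s : Fin 2 →₀ ℕ := Finsupp.single 0 (prm i).2.2.1 + Finsupp.single 1 (prm i).2.2.2
  let t : Fin 2 →₀ ℕ := Finsupp.single 0 (prm i).1 + Finsupp.single 1 (prm i).2.1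
  have hs0 : s 0 = (prm i).2.2.1 := by simp [s]
  have hs1 : s 1 = (prm i).2.2.2 := by simp [s]
  have ht0 : t 0 = (prm i).1 := by simp [t]
  have ht1 : t 1 = (prm i).2.1 := by simp [t]
  have hzero := hcomm.coeff_monomial_eq_zero (s := s) (t := t) 1 (by omega)
  rw [hD, LinearMap.sum_apply, coeff_sum, Finset.sum_eq_single i] at hzero
  · rw [LinearMap.smul_apply, coeff_smul, canB_monomial, hs0, hs1, Nat.descFactorial_self,
      Nat.descFactorial_self, coeff_monomial, if_pos, smul_eq_mul] at hzero
    · simp [hc i, Nat.factorial_ne_zero] at hzero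
    · ext k
      fin_cases k <;> simp [s, t]
  · intro j _ hj
    rw [LinearMap.smul_apply, coeff_smul, canB_monomial, hs0, hs1, coeff_monomial]
    split_ifs with h
    · by_cases hb : (prm i).2.2.2 < (prm j).2.2.2
      · simp [Nat.descFactorial_of_lt hb]
      by_cases ha : (prm i).2.2.1 < (prm j).2.2.1
      · simp [Nat.descFactorial_of_lt ha]
      have h0 := DFunLike.congr_fun h 0
      have h1 := DFunLike.congr_fun h 1
      simp [hs0, hs1, ht0, ht1] at h0 h1
      have hj' := @hmin j (by omega) (by omega)
      exact absurd (hinj (Prod.ext (by omega) (Prod.ext (by omega)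
        (Prod.ext (by omega) (by omega))))) hj
    · simp
  · simp
end
end

section
/- The four operators z z̄ (multiplication by z·z̄), z∂, z̄∂̄, and ∂∂̄ generate, as a ℂ-subalgebra of the Weyl algebra A₂, exactly the subalgebra 𝔑₂ of all operators in A₂ that commute with rotations. That is, the ℂ-subalgebra of the endomorphism algebra of ℂ[z, z̄] generated by {z z̄, z∂, z̄∂̄, ∂∂̄} equals { D ∈ A₂ : D ∘ R_θ = R_θ ∘ D for all θ ∈ [0, 2π) }. -/
open MvPolynomial

noncomputable section

lemma rot_mul_apply (θ : ℝ) (p q : P2) : rot θ (p * q) = rot θ p * rot θ q :=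
  map_mul (aeval _) p q

lemma rot_C (θ : ℝ) (a : ℂ) : rot θ (C a) = C a :=
  (aeval _).commutes a

lemma rot_X_zero (θ : ℝ) : rot θ (X 0) = Complex.exp (θ * Complex.I) • X 0 :=
  (aeval_X _ _).trans (if_pos rfl)

lemma rot_X_one (θ : ℝ) : rot θ (X 1) = Complex.exp (-(θ * Complex.I)) • X 1 :=
  (aeval_X _ _).trans (if_neg one_ne_zero)

lemma rot_mul_Mz (θ : ℝ) :
    rot θ * Mz = Complex.exp (θ * Complex.I) • (Mz * rot θ) := by
  refine LinearMap.ext fun p => ?_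
  simp [Mz, rot_mul_apply, rot_X_zero]

lemma rot_mul_Mzbar (θ : ℝ) :
    rot θ * Mzbar = Complex.exp (-(θ * Complex.I)) • (Mzbar * rot θ) := by
  refine LinearMap.ext fun p => ?_
  simp [Mzbar, rot_mul_apply, rot_X_one]

lemma rot_mul_Dz (θ : ℝ) :
    rot θ * Dz = Complex.exp (-(θ * Complex.I)) • (Dz * rot θ) := by
  refine LinearMap.ext fun p => ?_
  simp only [Dz, Module.End.mul_apply, LinearMap.smul_apply, Derivation.coeFn_coe]
  induction p using MvPolynomial.induction_on with
  | C a => simp [rot_C]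
  | add p q hp hq => simp only [map_add, smul_add, hp, hq]
  | mul_X p i hp =>
    fin_cases i <;>
      simp [Derivation.leibniz, hp, smul_smul, rot_mul_apply, rot_X_zero, rot_X_one,
        ← Complex.exp_add]

lemma rot_mul_Dzbar (θ : ℝ) :
    rot θ * Dzbar = Complex.exp (θ * Complex.I) • (Dzbar * rot θ) := by
  refine LinearMap.ext fun p => ?_
  simp only [Dzbar, Module.End.mul_apply, LinearMap.smul_apply, Derivation.coeFn_coe]
  induction p using MvPolynomial.induction_on with
  | C a => simp [rot_C]
  | add p q hp hq => simp only [map_add, smul_add, hp, hq]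
  | mul_X p i hp =>
    fin_cases i <;>
      simp [Derivation.leibniz, hp, smul_smul, rot_mul_apply, rot_X_zero, rot_X_one,
        ← Complex.exp_add]

lemma rot_mul_rot_neg (θ : ℝ) : rot θ * rot (-θ) = 1 := by
  have h : (rot θ * rot (-θ)) = (AlgHom.id ℂ P2).toLinearMap := by
    simp only [rot, Module.End.mul_eq_comp, ← AlgHom.comp_toLinearMap]
    congr 1
    ext1 i
    fin_cases i <;> simp [smul_smul, ← Complex.exp_add]
  rw [h]; rfl

lemma Mzbar_mul_Mz : Mzbar * Mz = Mz * Mzbar := by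
  refine LinearMap.ext fun p => ?_
  simp [Mz, Mzbar, mul_left_comm]

lemma Dz_mul_Mz : Dz * Mz = Mz * Dz + 1 := by
  refine LinearMap.ext fun p => ?_
  simp [Dz, Mz]

lemma Dzbar_mul_Mzbar : Dzbar * Mzbar = Mzbar * Dzbar + 1 := by
  refine LinearMap.ext fun p => ?_
  simp [Dzbar, Mzbar]

lemma Dz_mul_Mzbar : Dz * Mzbar = Mzbar * Dz := by
  refine LinearMap.ext fun p => ?_
  simp [Dz, Mzbar]

lemma Dzbar_mul_Mz : Dzbar * Mz = Mz * Dzbar := by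
  refine LinearMap.ext fun p => ?_
  simp [Dzbar, Mz]

lemma Dzbar_mul_Dz : Dzbar * Dz = Dz * Dzbar := by
  refine LinearMap.ext fun p => ?_
  simp only [Dz, Dzbar, Module.End.mul_apply, Derivation.coeFn_coe]
  induction p using MvPolynomial.induction_on with
  | C a => simp
  | add p q hp hq => simp only [map_add, hp, hq]
  | mul_X p i hp => fin_cases i <;> simp [Derivation.leibniz, hp, add_comm]

/-- The generators of the rotation-invariant operators. -/
abbrev invGens : Set (Module.End ℂ P2) :=
  {Mz * Mzbar, Mz * Dz, Mzbar * Dzbar, Dz * Dzbar}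

/-- The subalgebra generated by `invGens`, as a submodule. -/
abbrev invSub : Submodule ℂ (Module.End ℂ P2) :=
  Subalgebra.toSubmodule (Algebra.adjoin ℂ invGens)

/-- The span of the generators of `A₂` of weight `1`. -/
abbrev raising : Submodule ℂ (Module.End ℂ P2) := Submodule.span ℂ {Mz, Dzbar}

/-- The span of the generators of `A₂` of weight `-1`. -/
abbrev lowering : Submodule ℂ (Module.End ℂ P2) := Submodule.span ℂ {Mzbar, Dz}

lemma invSub_mul_self : invSub * invSub = invSub :=
  (Subalgebra.isIdempotentElem_toSubmodule _).eq

lemma raising_mul_lowering_le : raising * lowering ≤ invSub := by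
  rw [Submodule.span_mul_span, Submodule.span_le]
  rintro _ ⟨r, hr | hr, l, hl | hl, rfl⟩ <;> subst hr <;> subst hl <;>
    simp only [Dzbar_mul_Mzbar, Dzbar_mul_Dz]
  · exact Algebra.subset_adjoin (by simp)
  · exact Algebra.subset_adjoin (by simp)
  · exact add_mem (Algebra.subset_adjoin (by simp)) (one_mem (Algebra.adjoin ℂ invGens))
  · exact Algebra.subset_adjoin (by simp)

lemma lowering_mul_raising_le : lowering * raising ≤ invSub := by
  rw [Submodule.span_mul_span, Submodule.span_le]
  rintro _ ⟨l, hl | hl, r, hr | hr, rfl⟩ <;> subst hr <;> subst hl <;>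
    simp only [Mzbar_mul_Mz, Dz_mul_Mz]
  · exact Algebra.subset_adjoin (by simp)
  · exact Algebra.subset_adjoin (by simp)
  · exact add_mem (Algebra.subset_adjoin (by simp)) (one_mem (Algebra.adjoin ℂ invGens))
  · exact Algebra.subset_adjoin (by simp)

/-- If commutators with the generators `S` preserve `span T`, then `adjoin S` can be moved to the
right past `span T`. -/
lemma adjoin_mul_span_le {R A : Type*} [CommRing R] [Ring A] [Algebra R A] {S T : Set A}
    (h : ∀ s ∈ S, ∀ t ∈ T, s * t - t * s ∈ Submodule.span R T) :
    Subalgebra.toSubmodule (Algebra.adjoin R S) * Submodule.span R T ≤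
      Submodule.span R T * Subalgebra.toSubmodule (Algebra.adjoin R S) := by
  set B := Algebra.adjoin R S
  have hright {x b : A} (hx : x ∈ Submodule.span R T * Subalgebra.toSubmodule B) (hb : b ∈ B) :
      x * b ∈ Submodule.span R T * Subalgebra.toSubmodule B := by
    have := Submodule.mul_mem_mul hx ((Subalgebra.mem_toSubmodule B).2 hb)
    rwa [mul_assoc, (Subalgebra.isIdempotentElem_toSubmodule B).eq] at this
  have hV {x : A} (hx : x ∈ Submodule.span R T) :
      x ∈ Submodule.span R T * Subalgebra.toSubmodule B := by
    simpa using Submodule.mul_mem_mul hx ((Subalgebra.mem_toSubmodule B).2 (one_mem B))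
  rw [Submodule.mul_le]
  intro b hb
  rw [Subalgebra.mem_toSubmodule] at hb
  induction hb using Algebra.adjoin_induction with
  | mem s hs =>
    intro v hv
    induction hv using Submodule.span_induction with
    | mem t ht =>
      rw [← sub_add_cancel (s * t) (t * s)]
      exact add_mem (hV (h s hs t ht)) (Submodule.mul_mem_mul (Submodule.subset_span ht)
        (Algebra.subset_adjoin hs))
    | zero => simp
    | add x y _ _ hx hy => rw [mul_add]; exact add_mem hx hy
    | smul a x _ hx => rw [mul_smul_comm]; exact Submodule.smul_mem _ _ hx
  | algebraMap r =>
    intro v hv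
    rw [← Algebra.smul_def]
    exact hV (Submodule.smul_mem _ _ hv)
  | add x y _ _ hx hy => intro v hv; rw [add_mul]; exact add_mem (hx v hv) (hy v hv)
  | mul x y _ _ hx hy =>
    intro v hv
    rw [mul_assoc]
    refine Submodule.mul_induction_on (hy v hv) (fun w hw c hc => ?_) fun u w hu hw => ?_
    · rw [← mul_assoc]
      exact hright (hx w hw) hc
    · rw [mul_add]
      exact add_mem hu hw

lemma invSub_mul_raising_le : invSub * raising ≤ raising * invSub := by
  refine adjoin_mul_span_le ?_
  have hM : Mz ∈ raising := Submodule.subset_span (by simp)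
  have hD : Dzbar ∈ raising := Submodule.subset_span (by simp)
  rintro _ (rfl | rfl | rfl | rfl) _ (rfl | rfl)
  · convert zero_mem raising using 1
    rw [mul_assoc, Mzbar_mul_Mz, sub_self]
  · convert neg_mem hM using 1
    rw [← mul_assoc, Dzbar_mul_Mz, mul_assoc, mul_assoc, Dzbar_mul_Mzbar]; noncomm_ring
  · convert hM using 1
    rw [mul_assoc, Dz_mul_Mz]; noncomm_ring
  · convert zero_mem raising using 1
    rw [← mul_assoc, Dzbar_mul_Mz, mul_assoc, mul_assoc, Dzbar_mul_Dz, sub_self]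
  · convert zero_mem raising using 1
    rw [mul_assoc, Dzbar_mul_Mz, ← mul_assoc, ← mul_assoc, Mzbar_mul_Mz, sub_self]
  · convert neg_mem hD using 1
    rw [← mul_assoc, Dzbar_mul_Mzbar]; noncomm_ring
  · convert hD using 1
    rw [mul_assoc, Dzbar_mul_Mz, ← mul_assoc, Dz_mul_Mz]; noncomm_ring
  · convert zero_mem raising using 1
    rw [← mul_assoc, Dzbar_mul_Dz, sub_self]

lemma invSub_mul_lowering_le : invSub * lowering ≤ lowering * invSub := by
  refine adjoin_mul_span_le ?_
  have hM : Mzbar ∈ lowering := Submodule.subset_span (by simp)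
  have hD : Dz ∈ lowering := Submodule.subset_span (by simp)
  rintro _ (rfl | rfl | rfl | rfl) _ (rfl | rfl)
  · convert zero_mem lowering using 1
    rw [← mul_assoc, Mzbar_mul_Mz, sub_self]
  · convert neg_mem hM using 1
    rw [← mul_assoc, Dz_mul_Mz, mul_assoc, ← Dz_mul_Mzbar]; noncomm_ring
  · convert zero_mem lowering using 1
    rw [← mul_assoc, Mzbar_mul_Mz, mul_assoc, mul_assoc, Dz_mul_Mzbar, sub_self]
  · convert neg_mem hD using 1
    rw [← mul_assoc, Dz_mul_Mz]; noncomm_ring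
  · convert hM using 1
    rw [mul_assoc, Dzbar_mul_Mzbar]; noncomm_ring
  · convert zero_mem lowering using 1
    rw [← mul_assoc, Dz_mul_Mzbar, mul_assoc, mul_assoc, Dzbar_mul_Dz, sub_self]
  · convert hD using 1
    rw [mul_assoc, Dzbar_mul_Mzbar, ← mul_assoc, ← Dz_mul_Mzbar]; noncomm_ring
  · convert zero_mem lowering using 1
    rw [mul_assoc, Dzbar_mul_Dz, sub_self]

/-- The operators of weight `k`. -/
def weightSub : ℤ → Submodule ℂ (Module.End ℂ P2)
  | Int.ofNat n => raising ^ n * invSub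
  | Int.negSucc n => lowering ^ (n + 1) * invSub

lemma mul_pow_mul_eq_pow_succ_mul {M : Type*} [Monoid M] (u b : M) (n : ℕ) :
    u * (u ^ n * b) = u ^ (n + 1) * b := by
  rw [pow_succ', mul_assoc]

lemma mul_pow_mul_le {A : Type*} [Semiring A] [Algebra ℂ A] {B U L : Submodule ℂ A}
    (hB : B * B = B) (hBU : B * U ≤ U * B) (hLU : L * U ≤ B) (n : ℕ) :
    L * (U ^ (n + 1) * B) ≤ U ^ n * B := by
  have hpow (n : ℕ) : B * U ^ n ≤ U ^ n * B := by
    induction n with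
    | zero => simp
    | succ n ih =>
      calc B * U ^ (n + 1) = B * U ^ n * U := by rw [pow_succ, mul_assoc]
        _ ≤ U ^ n * B * U := by gcongr
        _ = U ^ n * (B * U) := mul_assoc _ _ _
        _ ≤ U ^ n * (U * B) := by gcongr
        _ = U ^ (n + 1) * B := by rw [pow_succ, mul_assoc]
  calc L * (U ^ (n + 1) * B) = L * U * U ^ n * B := by simp only [pow_succ', mul_assoc]
    _ ≤ B * U ^ n * B := by gcongr
    _ ≤ U ^ n * B * B := by gcongr ?_ * _; exact hpow n
    _ = U ^ n * B := by rw [mul_assoc, hB]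

lemma raising_mul_weightSub_le (k : ℤ) : raising * weightSub k ≤ weightSub (k + 1) := by
  obtain n | _ | n := k
  · exact (mul_pow_mul_eq_pow_succ_mul raising invSub n).le
  · simpa [weightSub] using mul_pow_mul_le invSub_mul_self invSub_mul_lowering_le
      raising_mul_lowering_le 0
  · exact mul_pow_mul_le invSub_mul_self invSub_mul_lowering_le
      raising_mul_lowering_le (n + 1)

lemma lowering_mul_weightSub_le (k : ℤ) : lowering * weightSub k ≤ weightSub (k - 1) := by
  obtain (_ | n) | n := k
  · exact (by simp : lowering * (raising ^ 0 * invSub) = lowering ^ (0 + 1) * invSub).le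
  · have := mul_pow_mul_le invSub_mul_self invSub_mul_raising_le
      lowering_mul_raising_le n
    have h : Int.ofNat (n + 1) - 1 = Int.ofNat n := by simp
    rw [h]
    exact this
  · exact (mul_pow_mul_eq_pow_succ_mul lowering invSub (n + 1)).le

lemma weylA2_le_iSup_weightSub :
    Subalgebra.toSubmodule WeylA2 ≤ ⨆ k, weightSub k := by
  have hgen (s) (hs : s ∈ ({Mz, Mzbar, Dz, Dzbar} : Set (Module.End ℂ P2))) (k : ℤ) (x)
      (hx : x ∈ weightSub k) : s * x ∈ ⨆ k, weightSub k := by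
    have hr (hs : s ∈ raising) : s * x ∈ ⨆ k, weightSub k :=
      le_iSup weightSub _ (raising_mul_weightSub_le k (Submodule.mul_mem_mul hs hx))
    have hl (hs : s ∈ lowering) : s * x ∈ ⨆ k, weightSub k :=
      le_iSup weightSub _ (lowering_mul_weightSub_le k (Submodule.mul_mem_mul hs hx))
    obtain rfl | rfl | rfl | rfl := hs
    · exact hr (Submodule.subset_span (by simp))
    · exact hl (Submodule.subset_span (by simp))
    · exact hl (Submodule.subset_span (by simp))
    · exact hr (Submodule.subset_span (by simp))
  have hmul (a) (ha : a ∈ WeylA2) : ∀ x ∈ ⨆ k, weightSub k, a * x ∈ ⨆ k, weightSub k := by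
    induction ha using Algebra.adjoin_induction with
    | mem s hs =>
      intro x hx
      induction hx using Submodule.iSup_induction' with
      | mem k x hx => exact hgen s hs k x hx
      | zero => simp
      | add x y _ _ hx hy => rw [mul_add]; exact add_mem hx hy
    | algebraMap r =>
      intro x hx
      rw [← Algebra.smul_def]
      exact Submodule.smul_mem _ _ hx
    | add a b _ _ ha hb => intro x hx; rw [add_mul]; exact add_mem (ha x hx) (hb x hx)
    | mul a b _ _ ha hb => intro x hx; rw [mul_assoc]; exact ha _ (hb x hx)
  intro a ha
  have h1 : (1 : Module.End ℂ P2) ∈ weightSub 0 := by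
    simp [weightSub]
  simpa using hmul a ha 1 (le_iSup weightSub 0 h1)

/-- Conjugation by the rotation operator `R_θ`. -/
def rotConj (θ : ℝ) : Module.End ℂ (Module.End ℂ P2) :=
  LinearMap.mulLeft ℂ (rot θ) ∘ₗ LinearMap.mulRight ℂ (rot (-θ))

lemma mem_eigenspace_rotConj_iff (θ : ℝ) (c : ℂ) (D : Module.End ℂ P2) :
    D ∈ (rotConj θ).eigenspace c ↔ rot θ * D = c • (D * rot θ) := by
  have h : rot (-θ) * rot θ = 1 := by simpa using rot_mul_rot_neg (-θ)
  rw [Module.End.mem_eigenspace_iff]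
  simp only [rotConj, LinearMap.comp_apply, LinearMap.mulLeft_apply, LinearMap.mulRight_apply]
  constructor <;> intro hD
  · rw [← smul_mul_assoc, ← hD, mul_assoc, mul_assoc, h, mul_one]
  · rw [← mul_assoc, hD, smul_mul_assoc, mul_assoc, rot_mul_rot_neg, mul_one]

lemma eigenspace_rotConj_mul_le (θ : ℝ) (a b : ℂ) :
    (rotConj θ).eigenspace a * (rotConj θ).eigenspace b ≤ (rotConj θ).eigenspace (a * b) := by
  rw [Submodule.mul_le]
  intro x hx y hy
  rw [mem_eigenspace_rotConj_iff] at *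
  rw [← mul_assoc, hx, smul_mul_assoc, mul_assoc, hy, mul_smul_comm, smul_smul, mul_assoc]

lemma raising_le_eigenspace (θ : ℝ) :
    raising ≤ (rotConj θ).eigenspace (Complex.exp (θ * Complex.I)) := by
  rw [Submodule.span_le]
  rintro _ (rfl | rfl) <;> rw [SetLike.mem_coe, mem_eigenspace_rotConj_iff]
  · exact rot_mul_Mz θ
  · exact rot_mul_Dzbar θ

lemma lowering_le_eigenspace (θ : ℝ) :
    lowering ≤ (rotConj θ).eigenspace (Complex.exp (θ * Complex.I))⁻¹ := by
  rw [Submodule.span_le, ← Complex.exp_neg]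
  rintro _ (rfl | rfl) <;> rw [SetLike.mem_coe, mem_eigenspace_rotConj_iff]
  · exact rot_mul_Mzbar θ
  · exact rot_mul_Dz θ

lemma commute_rot_of_mem_adjoin (θ : ℝ) {D : Module.End ℂ P2}
    (hD : D ∈ Algebra.adjoin ℂ invGens) : Commute (rot θ) D := by
  have h (x) (hx : x ∈ raising * lowering ⊔ lowering * raising) : rot θ * x = x * rot θ := by
    have hle : raising * lowering ⊔ lowering * raising ≤ (rotConj θ).eigenspace 1 := by
      have hne := Complex.exp_ne_zero (θ * Complex.I)
      have h1 := eigenspace_rotConj_mul_le θ (Complex.exp (θ * Complex.I))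
        (Complex.exp (θ * Complex.I))⁻¹
      have h2 := eigenspace_rotConj_mul_le θ (Complex.exp (θ * Complex.I))⁻¹
        (Complex.exp (θ * Complex.I))
      rw [mul_inv_cancel₀ hne] at h1
      rw [inv_mul_cancel₀ hne] at h2
      exact sup_le
        ((mul_le_mul' (raising_le_eigenspace θ) (lowering_le_eigenspace θ)).trans h1)
        ((mul_le_mul' (lowering_le_eigenspace θ) (raising_le_eigenspace θ)).trans h2)
    simpa only [one_smul] using (mem_eigenspace_rotConj_iff θ 1 x).1 (hle hx)
  refine Algebra.commute_of_mem_adjoin_of_forall_mem_commute hD ?_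
  rintro _ (rfl | rfl | rfl | rfl)
  · exact h _ (Submodule.mem_sup_left (Submodule.mul_mem_mul
      (Submodule.subset_span (by simp)) (Submodule.subset_span (by simp))))
  · exact h _ (Submodule.mem_sup_left (Submodule.mul_mem_mul
      (Submodule.subset_span (by simp)) (Submodule.subset_span (by simp))))
  · exact h _ (Submodule.mem_sup_right (Submodule.mul_mem_mul
      (Submodule.subset_span (by simp)) (Submodule.subset_span (by simp))))
  · exact h _ (Submodule.mem_sup_right (Submodule.mul_mem_mul
      (Submodule.subset_span (by simp)) (Submodule.subset_span (by simp))))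

lemma weightSub_le_eigenspace (θ : ℝ) (k : ℤ) :
    weightSub k ≤ (rotConj θ).eigenspace (Complex.exp (θ * Complex.I) ^ k) := by
  have hB : invSub ≤ (rotConj θ).eigenspace 1 := by
    intro D hD
    rw [mem_eigenspace_rotConj_iff, one_smul]
    exact commute_rot_of_mem_adjoin θ hD
  have hpow {V : Submodule ℂ (Module.End ℂ P2)} {c : ℂ} (hV : V ≤ (rotConj θ).eigenspace c)
      (n : ℕ) : V ^ n * invSub ≤ (rotConj θ).eigenspace (c ^ n) := by
    induction n with
    | zero => simpa using hB
    | succ n ih =>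
      rw [pow_succ' c]
      refine (mul_pow_mul_eq_pow_succ_mul V invSub n).ge.trans ?_
      exact (mul_le_mul' hV ih).trans (eigenspace_rotConj_mul_le θ _ _)
  cases k with
  | ofNat n => simpa [weightSub] using hpow (raising_le_eigenspace θ) n
  | negSucc n => simpa [weightSub, zpow_negSucc] using hpow (lowering_le_eigenspace θ) (n + 1)

lemma exp_I_zpow_ne_one {k : ℤ} (hk : k ≠ 0) :
    Complex.exp (((1 : ℝ) : ℂ) * Complex.I) ^ k ≠ 1 := by
  rw [← Complex.exp_int_mul, Ne, Complex.exp_eq_one_iff]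
  rintro ⟨n, hn⟩
  have h : (k : ℝ) = n * (2 * Real.pi) := by
    have := congrArg Complex.im hn
    simpa using this
  have hn0 : n ≠ 0 := by
    rintro rfl
    simp [hk] at h
  refine irrational_pi ⟨k / (2 * n), ?_⟩
  have : (n : ℝ) ≠ 0 := by exact_mod_cast hn0
  push_cast
  rw [h]
  field_simp

/-- the ℂ-subalgebra generated by `z z̄`, `z∂`, `z̄∂̄`, `∂∂̄`
equals the set of operators in `A₂` commuting with rotations. -/
theorem adjoin_eq_rotationInvariant :
    (Algebra.adjoin ℂ
        ({Mz * Mzbar, Mz * Dz, Mzbar * Dzbar, Dz * Dzbar} : Set (Module.End ℂ P2)) :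
      Set (Module.End ℂ P2)) =
      {D : Module.End ℂ P2 | D ∈ WeylA2 ∧ CommutesWithRotations D} := by
  refine Set.Subset.antisymm (fun D hD => ⟨?_, fun θ _ _ => ?_⟩) ?_
  · have hz : Mz ∈ WeylA2 := Algebra.subset_adjoin (by simp)
    have hzbar : Mzbar ∈ WeylA2 := Algebra.subset_adjoin (by simp)
    have hd : Dz ∈ WeylA2 := Algebra.subset_adjoin (by simp)
    have hdbar : Dzbar ∈ WeylA2 := Algebra.subset_adjoin (by simp)
    refine Algebra.adjoin_le ?_ hD
    rintro _ (rfl | rfl | rfl | rfl)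
    exacts [mul_mem hz hzbar, mul_mem hz hd, mul_mem hzbar hdbar, mul_mem hd hdbar]
  · exact (commute_rot_of_mem_adjoin θ hD).eq.symm
  · rintro D ⟨hW, hD⟩
    have hD1 : D ∈ (rotConj 1).eigenspace 1 := by
      rw [mem_eigenspace_rotConj_iff, one_smul]
      exact (hD 1 zero_le_one (by linarith [Real.pi_gt_three])).symm
    have hsup := weylA2_le_iSup_weightSub hW
    rw [iSup_split_single _ 0, Submodule.mem_sup] at hsup
    obtain ⟨x, hx, y, hy, rfl⟩ := hsup
    have hx1 : x ∈ (rotConj 1).eigenspace 1 := by simpa using weightSub_le_eigenspace 1 0 hx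
    have hy1 : y ∈ (rotConj 1).eigenspace 1 := by simpa using sub_mem hD1 hx1
    have hle : ⨆ (k : ℤ) (_ : k ≠ 0), weightSub k ≤
        ⨆ (c : ℂ) (_ : c ≠ 1), (rotConj 1).eigenspace c :=
      iSup₂_le fun k hk => (weightSub_le_eigenspace 1 k).trans
        (le_iSup₂_of_le _ (exp_I_zpow_ne_one hk) le_rfl)
    have hy0 : y = 0 :=
      Submodule.disjoint_def.1 ((rotConj 1).eigenspaces_iSupIndep 1) y hy1 (hle hy)
    rw [hy0, add_zero]
    simpa [weightSub] using hx
end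
end

section
/- Let φ ∈ ℂ[x] be a polynomial and m, n ∈ ℕ. Then, in ℂ[z, z̄], zⁿ ∂ⁿ (φ(|z|²) z^m) = ∑_{l=0}^{n} C(n, l) · (m − l + 1)_l · |z|^{2(n−l)} φ^{(n−l)}(|z|²) · z^m, where C(n, l) is the binomial coefficient, (a)_l is the rising factorial, and φ^{(k)} is the k-th derivative of φ. Moreover, for m ∈ ℕ with m > 0 and any n ∈ ℕ, zⁿ ∂ⁿ (φ(|z|²) z̄^m) = |z|^{2n} φ^{(n)}(|z|²) · z̄^m. -/
open MvPolynomial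

noncomputable section

/-- `ξ_m(z) = z^m` for `m ≥ 0`, and `ξ_m(z) = z̄^{|m|}` for `m < 0`. -/
def xi (m : ℤ) : P2 := if 0 ≤ m then (X 0 : P2) ^ m.toNat else (X 1 : P2) ^ m.natAbs

/-- Evaluation of a one-variable polynomial `φ ∈ ℂ[x]` at `|z|² = z z̄`,
giving `φ(|z|²) ∈ ℂ[z, z̄]`. -/
def evalZZ : Polynomial ℂ →ₐ[ℂ] P2 := Polynomial.aeval (X 0 * X 1 : P2)

/-- Iterated Leibniz rule for a derivation of a commutative algebra. -/
theorem Derivation.iterate_leibniz {R A : Type*} [CommSemiring R] [CommSemiring A] [Algebra R A]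
    (D : Derivation R A A) (f g : A) (n : ℕ) :
    D^[n] (f * g) =
      ∑ ij ∈ Finset.HasAntidiagonal.antidiagonal n, n.choose ij.1 • (D^[ij.1] f * D^[ij.2] g) := by
  induction n with
  | zero => simp
  | succ n ih =>
    rw [Function.iterate_succ_apply', ih,
      Finset.sum_antidiagonal_choose_succ_nsmul (fun i j => D^[i] f * D^[j] g) n, map_sum,
      ← Finset.sum_add_distrib]
    refine Finset.sum_congr rfl fun ij hij => ?_
    rw [Finset.HasAntidiagonal.mem_antidiagonal] at hij
    rw [← Nat.choose_symm_of_eq_add hij.symm, map_nsmul, Derivation.leibniz, ← nsmul_add]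
    simp only [Function.iterate_succ_apply', smul_eq_mul]
    ring

theorem Dz_pow_apply (n : ℕ) (f : P2) : (Dz ^ n) f = (pderiv (0 : Fin 2))^[n] f := by
  rw [Module.End.pow_apply]
  rfl

theorem pderiv_zero_evalZZ (φ : Polynomial ℂ) :
    pderiv (0 : Fin 2) (evalZZ φ) = X 1 * evalZZ (Polynomial.derivative φ) := by
  unfold evalZZ
  rw [Derivation.map_aeval, Derivation.leibniz, pderiv_X_self,
    pderiv_X_of_ne (by decide : (1 : Fin 2) ≠ 0)]
  simp [mul_comm]

theorem iterate_pderiv_zero_mul_X_one_pow (f : P2) (m n : ℕ) :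
    (pderiv (0 : Fin 2))^[n] (f * X 1 ^ m) = (pderiv (0 : Fin 2))^[n] f * X 1 ^ m := by
  induction n with
  | zero => rfl
  | succ n ih =>
    rw [Function.iterate_succ_apply', ih, Function.iterate_succ_apply', Derivation.leibniz,
      Derivation.leibniz_pow, pderiv_X_of_ne (by decide : (1 : Fin 2) ≠ 0)]
    simp [mul_comm]

theorem iterate_pderiv_zero_evalZZ (φ : Polynomial ℂ) (n : ℕ) :
    (pderiv (0 : Fin 2))^[n] (evalZZ φ) =
      evalZZ (Polynomial.derivative^[n] φ) * (X 1 : P2) ^ n := by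
  induction n generalizing φ with
  | zero => simp
  | succ n ih =>
    rw [Function.iterate_succ_apply, pderiv_zero_evalZZ, Function.iterate_succ_apply, mul_comm,
      ← pow_one (X 1 : P2), iterate_pderiv_zero_mul_X_one_pow, ih]
    ring

theorem X_zero_pow_mul_iterate_pderiv_zero (m l : ℕ) :
    (X 0 : P2) ^ l * (pderiv (0 : Fin 2))^[l] ((X 0 : P2) ^ m) =
      (m.descFactorial l : P2) * (X 0 : P2) ^ m := by
  have h : (pderiv (0 : Fin 2))^[l] ((X 0 : P2) ^ m) =
      (m.descFactorial l : P2) * (X 0 : P2) ^ (m - l) := by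
    induction l with
    | zero => simp
    | succ l ih =>
      rw [Function.iterate_succ_apply', ih, Derivation.leibniz, Derivation.leibniz_pow,
        Derivation.map_natCast, pderiv_X_self, Nat.descFactorial_succ, Nat.sub_sub]
      simp
      ring
  rw [h]
  rcases le_or_gt l m with hl | hl
  · rw [mul_left_comm, ← pow_add, Nat.add_sub_cancel' hl]
  · simp [Nat.descFactorial_eq_zero_iff_lt.2 hl]

theorem ascPochhammer_eval_sub_add_one (m l : ℕ) :
    (ascPochhammer ℂ l).eval ((m : ℂ) - l + 1) = m.descFactorial l := by
  rw [← descPochhammer_eval_eq_ascPochhammer, descPochhammer_eval_eq_descFactorial]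

/-- the action of `zⁿ∂ⁿ` on `φ(|z|²) z^m` and on `φ(|z|²) z̄^m`
(`m > 0`); `(a)_l` is the rising factorial `ascPochhammer`. -/
theorem zn_dzn_on_component (φ : Polynomial ℂ) (m n : ℕ) :
    ((X 0 : P2) ^ n * (Dz ^ n) (evalZZ φ * (X 0 : P2) ^ m) =
      ∑ l ∈ Finset.range (n + 1),
        ((n.choose l : ℂ) * (ascPochhammer ℂ l).eval ((m : ℂ) - l + 1)) •
          ((X 0 * X 1 : P2) ^ (n - l) * evalZZ (Polynomial.derivative^[n - l] φ) *
            (X 0 : P2) ^ m)) ∧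
    (0 < m →
      (X 0 : P2) ^ n * (Dz ^ n) (evalZZ φ * (X 1 : P2) ^ m) =
        (X 0 * X 1 : P2) ^ n * evalZZ (Polynomial.derivative^[n] φ) * (X 1 : P2) ^ m) := by
  simp only [Dz_pow_apply]
  refine ⟨?_, fun _ => ?_⟩
  · rw [mul_comm (evalZZ φ), Derivation.iterate_leibniz,
      Finset.Nat.sum_antidiagonal_eq_sum_range_succ_mk, Finset.mul_sum]
    refine Finset.sum_congr rfl fun l hl => ?_
    have hln : l ≤ n := Nat.lt_succ_iff.1 (Finset.mem_range.1 hl)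
    have hX : (X 0 : P2) ^ n = X 0 ^ (n - l) * X 0 ^ l := by
      rw [← pow_add, Nat.sub_add_cancel hln]
    have hz := X_zero_pow_mul_iterate_pderiv_zero m l
    rw [ascPochhammer_eval_sub_add_one, iterate_pderiv_zero_evalZZ, hX, ← Nat.cast_mul,
      Nat.cast_smul_eq_nsmul, nsmul_eq_mul, nsmul_eq_mul, Nat.cast_mul, mul_pow]
    linear_combination (n.choose l : P2) * (X 0 : P2) ^ (n - l) * (X 1 : P2) ^ (n - l) *
      evalZZ (Polynomial.derivative^[n - l] φ) * hz
  · rw [iterate_pderiv_zero_mul_X_one_pow, iterate_pderiv_zero_evalZZ]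
    ring
end
end

section
/- Let φ ∈ ℂ[x] be a polynomial, n ∈ ℕ, and m ∈ ℤ. Then, in ℂ[z, z̄], ∂ⁿ ∂̄ⁿ (φ(|z|²) ξ_m(z)) = ∑_{l=0}^{n} C(n, l) · ((|m| + n)! / (|m| + n − l)!) · |z|^{2(n−l)} φ^{(2n−l)}(|z|²) · ξ_m(z), where C(n, l) is the binomial coefficient and φ^{(k)} is the k-th derivative of φ. -/
open MvPolynomial

noncomputable section

open Finset in
/-- The general Leibniz rule for iterates of a derivation. -/
theorem Derivation.iterate_mul {R A : Type*} [CommSemiring R] [CommSemiring A] [Algebra R A]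
    (D : Derivation R A A) (n : ℕ) (a b : A) :
    D^[n] (a * b) = ∑ l ∈ range (n + 1), n.choose l • (D^[l] a * D^[n - l] b) := by
  rw [← Nat.sum_antidiagonal_eq_sum_range_succ (fun i j ↦ n.choose i • (D^[i] a * D^[j] b)) n]
  induction n with
  | zero => simp
  | succ n ih =>
    rw [sum_antidiagonal_choose_succ_nsmul (fun i j ↦ D^[i] a * D^[j] b) n]
    simp only [Function.iterate_succ_apply', ih, map_sum, map_nsmul, D.leibniz, smul_eq_mul,
      smul_add, sum_add_distrib]
    congr 1
    refine sum_congr rfl fun ⟨i, j⟩ hij ↦ ?_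
    rw [n.choose_symm_of_eq_add (mem_antidiagonal.1 hij).symm, mul_comm]

namespace MvPolynomial

section

variable {σ R : Type*} [CommSemiring R]

theorem iterate_pderiv_X_pow (i : σ) (k l : ℕ) :
    (pderiv i)^[l] (X i ^ k : MvPolynomial σ R) = k.descFactorial l • X i ^ (k - l) := by
  induction l with
  | zero => simp
  | succ l ih =>
    rw [Function.iterate_succ_apply', ih, map_nsmul, pderiv_pow, pderiv_X_self,
      Nat.descFactorial_succ, Nat.sub_sub]
    simp only [nsmul_eq_mul]
    push_cast
    ring

theorem iterate_pderiv_X_pow_mul_aeval {i j : σ} (h : i ≠ j) (k n : ℕ) (φ : Polynomial R) :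
    (pderiv j)^[n] (X i ^ k * Polynomial.aeval (X i * X j : MvPolynomial σ R) φ) =
      X i ^ (k + n) * Polynomial.aeval (X i * X j) (Polynomial.derivative^[n] φ) := by
  induction n with
  | zero => simp
  | succ n ih =>
    rw [Function.iterate_succ_apply', ih, Function.iterate_succ_apply', pderiv_mul, pderiv_pow,
      pderiv_X_of_ne h, Derivation.map_aeval, pderiv_mul, pderiv_X_of_ne h, pderiv_X_self,
      smul_eq_mul]
    ring

theorem iterate_pderiv_iterate_pderiv_aeval_mul_X_pow {i j : σ} (h : i ≠ j) (k n : ℕ)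
    (φ : Polynomial R) :
    (pderiv i)^[n] ((pderiv j)^[n]
        (Polynomial.aeval (X i * X j : MvPolynomial σ R) φ * X i ^ k)) =
      ∑ l ∈ Finset.range (n + 1), (n.choose l * (k + n).descFactorial l) •
        ((X i * X j) ^ (n - l) *
          Polynomial.aeval (X i * X j) (Polynomial.derivative^[2 * n - l] φ) * X i ^ k) := by
  rw [mul_comm, iterate_pderiv_X_pow_mul_aeval h, Derivation.iterate_mul]
  refine Finset.sum_congr rfl fun l hl ↦ ?_
  have hl : l ≤ n := Nat.lt_succ_iff.1 (Finset.mem_range.1 hl)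
  have key := iterate_pderiv_X_pow_mul_aeval h.symm 0 (n - l) (Polynomial.derivative^[n] φ)
  rw [pow_zero, one_mul, zero_add, mul_comm (X j), ← Function.iterate_add_apply,
    show n - l + n = 2 * n - l by omega] at key
  rw [iterate_pderiv_X_pow, key, show k + n - l = k + (n - l) by omega, mul_smul, smul_mul_assoc]
  congr 2
  ring

end

theorem pderiv_commute {σ R : Type*} [CommRing R] (i j : σ) :
    Commute (pderiv (R := R) i).toLinearMap (pderiv (R := R) j).toLinearMap := by
  classical
  have h : ⁅pderiv (R := R) i, pderiv (R := R) j⁆ = 0 := by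
    refine derivation_ext fun k ↦ ?_
    rw [Derivation.commutator_apply, pderiv_X i, pderiv_X j, Pi.single_apply, Pi.single_apply]
    split_ifs <;> simp
  refine LinearMap.ext fun p ↦ sub_eq_zero.1 ?_
  simpa [Derivation.commutator_apply] using DFunLike.congr_fun h p

end MvPolynomial

/-- the action of `∂ⁿ∂̄ⁿ` on `φ(|z|²) ξ_m(z)`:
`∂ⁿ∂̄ⁿ(φ(|z|²) ξ_m) = ∑_{l=0}^{n} C(n,l) ((|m|+n)!/(|m|+n−l)!)
|z|^{2(n−l)} φ^{(2n−l)}(|z|²) ξ_m`. -/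
theorem dzn_dzbarn_on_component (φ : Polynomial ℂ) (n : ℕ) (m : ℤ) :
    (Dz ^ n * Dzbar ^ n) (evalZZ φ * xi m) =
      ∑ l ∈ Finset.range (n + 1),
        ((n.choose l : ℂ) *
            (((m.natAbs + n).factorial / (m.natAbs + n - l).factorial : ℕ) : ℂ)) •
          ((X 0 * X 1 : P2) ^ (n - l) *
            evalZZ (Polynomial.derivative^[2 * n - l] φ) * xi m) := by
  have coeff (l : ℕ) (hl : l ∈ Finset.range (n + 1)) (p : P2) :
      ((n.choose l : ℂ) *
        (((m.natAbs + n).factorial / (m.natAbs + n - l).factorial : ℕ) : ℂ)) • p =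
      (n.choose l * (m.natAbs + n).descFactorial l) • p := by
    have := Finset.mem_range.1 hl
    rw [Nat.descFactorial_eq_div (by omega), ← Nat.cast_mul, Nat.cast_smul_eq_nsmul]
  rw [Finset.sum_congr rfl fun l hl ↦ coeff l hl _]
  by_cases hm : 0 ≤ m
  · have hx : xi m = X 0 ^ m.natAbs := by
      rw [xi, if_pos hm, show m.toNat = m.natAbs by omega]
    rw [hx, Module.End.mul_apply, Module.End.pow_apply, Module.End.pow_apply]
    exact iterate_pderiv_iterate_pderiv_aeval_mul_X_pow (by decide) m.natAbs n φ
  · have hx : xi m = X 1 ^ m.natAbs := by rw [xi, if_neg hm]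
    have hc : Dz ^ n * Dzbar ^ n = Dzbar ^ n * Dz ^ n := (pderiv_commute 0 1).pow_pow n n
    rw [hx, hc, Module.End.mul_apply, Module.End.pow_apply, Module.End.pow_apply, evalZZ,
      mul_comm (X 0 : P2)]
    exact iterate_pderiv_iterate_pderiv_aeval_mul_X_pow (by decide) m.natAbs n φ
end
end

section
/- Let S be a finite subset of ℤ and let N_S be the ℂ[|z|²]-submodule of ℂ[z, z̄] spanned by the elements ξ_m(z) for m ∈ S, i.e. the set of all finite sums ∑_{m ∈ S} p_m(|z|²) ξ_m(z) with p_m ∈ ℂ[x]. Then N_S is invariant under every operator D in the Weyl algebra A₂ that commutes with rotations: D(N_S) ⊆ N_S. -/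
open MvPolynomial

noncomputable section

/-- Multiplication by `x` on ℂ[x]. -/
def Mx : Module.End ℂ (Polynomial ℂ) := LinearMap.mulLeft ℂ (Polynomial.X : Polynomial ℂ)

/-- The formal derivative `d/dx` on ℂ[x]. -/
def Dx : Module.End ℂ (Polynomial ℂ) := Polynomial.derivative

/-- The first Weyl algebra `A₁`, generated by `x` and `d/dx`. -/
def WeylA1 : Subalgebra ℂ (Module.End ℂ (Polynomial ℂ)) :=
  Algebra.adjoin ℂ {Mx, Dx}

/-- The rotation operator as an algebra homomorphism. -/
def rotHom (θ : ℝ) : P2 →ₐ[ℂ] P2 :=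
  aeval (fun i : Fin 2 => if i = 0 then (Complex.exp (θ * Complex.I)) • (X 0 : P2)
    else (Complex.exp (-(θ * Complex.I))) • (X 1 : P2))

theorem rot_apply (θ : ℝ) (f : P2) : rot θ f = rotHom θ f := rfl

theorem rotHom_X_zero (θ : ℝ) :
    rotHom θ (X 0) = Complex.exp (θ * Complex.I) • (X 0 : P2) := by
  simp [rotHom]

theorem rotHom_X_one (θ : ℝ) :
    rotHom θ (X 1) = Complex.exp (-(θ * Complex.I)) • (X 1 : P2) := by
  simp [rotHom]

theorem monomial_eq_mul_X_pow (d : Fin 2 →₀ ℕ) (c : ℂ) :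
    (monomial d c : P2) = C c * (X 0 ^ d 0 * X 1 ^ d 1) := by
  rw [monomial_eq, Finsupp.prod_fintype _ _ (fun i => pow_zero _), Fin.prod_univ_two]

theorem rotHom_monomial (θ : ℝ) (d : Fin 2 →₀ ℕ) (c : ℂ) :
    rotHom θ (monomial d c) =
      Complex.exp ((((d 0 : ℤ) - d 1 : ℤ) : ℂ) * (θ * Complex.I)) • (monomial d c : P2) := by
  have h : Complex.exp ((((d 0 : ℤ) - d 1 : ℤ) : ℂ) * (θ * Complex.I)) =
      Complex.exp (θ * Complex.I) ^ d 0 * Complex.exp (-(θ * Complex.I)) ^ d 1 := by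
    rw [← Complex.exp_nat_mul, ← Complex.exp_nat_mul, ← Complex.exp_add]
    congr 1
    push_cast
    ring
  rw [monomial_eq_mul_X_pow, map_mul, map_mul, map_pow, map_pow, rotHom_X_zero, rotHom_X_one,
    h, smul_pow, smul_pow, smul_mul_smul_comm, mul_smul_comm]
  simp [rotHom, algHom_C]

theorem coeff_rotHom (θ : ℝ) (f : P2) (d : Fin 2 →₀ ℕ) :
    coeff d (rotHom θ f) =
      Complex.exp ((((d 0 : ℤ) - d 1 : ℤ) : ℂ) * (θ * Complex.I)) * coeff d f := by
  induction f using MvPolynomial.induction_on' with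
  | monomial e c =>
    rw [rotHom_monomial, coeff_smul, smul_eq_mul, coeff_monomial]
    split_ifs with h
    · rw [h]
    · simp
  | add p q hp hq => rw [map_add, coeff_add, coeff_add, hp, hq, mul_add]

theorem rotHom_evalZZ (θ : ℝ) (p : Polynomial ℂ) : rotHom θ (evalZZ p) = evalZZ p := by
  have h : (rotHom θ).comp evalZZ = evalZZ := by
    apply Polynomial.algHom_ext
    simp only [AlgHom.comp_apply, evalZZ, Polynomial.aeval_X, map_mul, rotHom_X_zero,
      rotHom_X_one]
    rw [smul_mul_smul_comm, ← Complex.exp_add]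
    simp
  exact DFunLike.congr_fun h p

theorem rotHom_xi (θ : ℝ) (m : ℤ) :
    rotHom θ (xi m) = Complex.exp ((m : ℂ) * (θ * Complex.I)) • xi m := by
  unfold xi
  split_ifs with h
  · lift m to ℕ using h
    rw [map_pow, rotHom_X_zero, smul_pow, ← Complex.exp_nat_mul]
    simp
  · obtain ⟨n, rfl⟩ : ∃ n : ℕ, m = -(n : ℤ) := ⟨m.natAbs, by omega⟩
    rw [map_pow, rotHom_X_one, smul_pow, ← Complex.exp_nat_mul]
    simp

theorem rotHom_evalZZ_mul_xi (θ : ℝ) (p : Polynomial ℂ) (m : ℤ) :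
    rotHom θ (evalZZ p * xi m) =
      Complex.exp ((m : ℂ) * (θ * Complex.I)) • (evalZZ p * xi m) := by
  rw [map_mul, rotHom_evalZZ, rotHom_xi, mul_smul_comm]

theorem X_pow_mul_X_pow_eq (a b : ℕ) :
    (X 0 ^ a * X 1 ^ b : P2) = (X 0 * X 1) ^ min a b * xi ((a : ℤ) - b) := by
  unfold xi
  rcases le_total b a with h | h
  · obtain ⟨c, rfl⟩ := Nat.exists_eq_add_of_le h
    have hc : (((b + c : ℕ) : ℤ) - b) = (c : ℤ) := by push_cast; ring
    rw [hc, if_pos (Int.natCast_nonneg c), Int.toNat_natCast, min_eq_right h]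
    ring
  · obtain ⟨c, rfl⟩ := Nat.exists_eq_add_of_le h
    rw [min_eq_left h]
    split_ifs with h0
    · obtain rfl : c = 0 := by omega
      simp [mul_pow]
    · have hc : ((a : ℤ) - (a + c : ℕ)).natAbs = c := by omega
      rw [hc]
      ring

/-- A polynomial all of whose monomials have weight `m` is a multiple of `xi m` over
`ℂ[z z̄]`. -/
theorem exists_evalZZ_mul_xi (f : P2) (m : ℤ)
    (h : ∀ d, coeff d f ≠ 0 → (d 0 : ℤ) - d 1 = m) :
    ∃ p : Polynomial ℂ, f = evalZZ p * xi m := by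
  refine ⟨∑ d ∈ f.support, Polynomial.C (coeff d f) * Polynomial.X ^ min (d 0) (d 1), ?_⟩
  conv_lhs => rw [f.as_sum]
  rw [map_sum, Finset.sum_mul]
  refine Finset.sum_congr rfl fun d hd => ?_
  rw [monomial_eq_mul_X_pow, X_pow_mul_X_pow_eq, h d (mem_support_iff.mp hd), ← mul_assoc]
  simp [evalZZ, MvPolynomial.algebraMap_eq]

/-- The rotation characters separate integers. -/
theorem eq_of_forall_exp_eq (k m : ℤ)
    (h : ∀ θ : ℝ, 0 ≤ θ → θ < 2 * Real.pi →
      Complex.exp ((k : ℂ) * (θ * Complex.I)) = Complex.exp ((m : ℂ) * (θ * Complex.I))) :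
    k = m := by
  have h1 := h 1 zero_le_one (by linarith [Real.pi_gt_three])
  obtain ⟨n, hn⟩ := Complex.exp_eq_exp_iff_exists_int.mp h1
  have hre : (k : ℝ) = m + n * (2 * Real.pi) := by
    simpa using congrArg Complex.im hn
  rcases eq_or_ne n 0 with rfl | hn0
  · exact_mod_cast (by simpa using hre : (k : ℝ) = m)
  · refine absurd ⟨((k - m : ℤ) : ℚ) / ((2 * n : ℤ) : ℚ), ?_⟩ irrational_pi
    have hnr : (n : ℝ) ≠ 0 := by exact_mod_cast hn0
    push_cast
    field_simp
    linarith

/-- for a finite `S ⊆ ℤ`, the `ℂ[|z|²]`-submodule `N_S` spanned by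
`{ξ_m : m ∈ S}` is invariant under every `D ∈ A₂` commuting with rotations. -/
theorem NS_invariant (S : Finset ℤ) (D : Module.End ℂ P2)
    (hD : D ∈ WeylA2) (hcomm : CommutesWithRotations D)
    (φ : ℤ → Polynomial ℂ) :
    ∃ ψ : ℤ → Polynomial ℂ,
      D (∑ m ∈ S, evalZZ (φ m) * xi m) = ∑ m ∈ S, evalZZ (ψ m) * xi m := by
  have key : ∀ m : ℤ, ∃ p : Polynomial ℂ, D (evalZZ (φ m) * xi m) = evalZZ p * xi m := by
    intro m
    refine exists_evalZZ_mul_xi _ m fun d hd => eq_of_forall_exp_eq _ _ fun θ h0 h2 => ?_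
    have hrot : rotHom θ (D (evalZZ (φ m) * xi m)) =
        Complex.exp ((m : ℂ) * (θ * Complex.I)) • D (evalZZ (φ m) * xi m) := by
      have := LinearMap.congr_fun (hcomm θ h0 h2) (evalZZ (φ m) * xi m)
      rw [Module.End.mul_apply, Module.End.mul_apply, rot_apply, rot_apply,
        rotHom_evalZZ_mul_xi, map_smul] at this
      exact this.symm
    have hcoeff := congrArg (coeff d) hrot
    rw [coeff_rotHom, coeff_smul, smul_eq_mul] at hcoeff
    exact mul_right_cancel₀ hd hcoeff
  choose ψ hψ using key
  exact ⟨ψ, by rw [map_sum]; exact Finset.sum_congr rfl fun m _ => hψ m⟩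
end
end

section
/- Let n ∈ ℕ be positive and let p ∈ ℂ[z, z̄] satisfy ∂ⁿ ∂̄ⁿ p = 0. Then there exist harmonic polynomials q₀, q₁, …, q_{n−1} ∈ ℂ[z, z̄] (i.e. ∂ ∂̄ q_j = 0 for all j) such that p(z, z̄) = q₀(z, z̄) + (1 − |z|²) q₁(z, z̄) + … + (1 − |z|²)^{n−1} q_{n−1}(z, z̄). -/
open MvPolynomial

noncomputable section

theorem coeff_add_single_eq_zero_of_coeff_pderiv_pow {σ : Type*} (i : σ) (n : ℕ)
    (p : MvPolynomial σ ℂ) (m : σ →₀ ℕ)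
    (h : coeff m (((pderiv i).toLinearMap ^ n : Module.End ℂ (MvPolynomial σ ℂ)) p) = 0) :
    coeff (m + Finsupp.single i n) p = 0 := by
  induction n generalizing p with
  | zero => simpa using h
  | succ n ih =>
    rw [pow_succ, Module.End.mul_apply] at h
    have h' := ih _ h
    rw [Derivation.coeFn_coe, coeff_pderiv, mul_eq_zero, add_assoc,
      ← Finsupp.single_add] at h'
    exact h'.resolve_right (Nat.cast_add_one_ne_zero _)

/-- The polynomials `∑_{j < n} (1 - |z|²) ^ j * q_j` with all `q_j` harmonic. -/
def almansiSpace : ℕ → Submodule ℂ P2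
  | 0 => ⊥
  | n + 1 => LinearMap.ker (Dz * Dzbar) ⊔
      (almansiSpace n).map (LinearMap.mulLeft ℂ (1 - X 0 * X 1 : P2))

theorem exists_of_mem_almansiSpace {n : ℕ} {p : P2} (hp : p ∈ almansiSpace n) :
    ∃ q : Fin n → P2, (∀ j, (Dz * Dzbar) (q j) = 0) ∧
      p = ∑ j : Fin n, (1 - X 0 * X 1 : P2) ^ (j : ℕ) * q j := by
  induction n generalizing p with
  | zero => exact ⟨Fin.elim0, fun j => j.elim0, by simpa [almansiSpace] using hp⟩
  | succ n ih =>
    obtain ⟨h, hh, _, ⟨s, hs, rfl⟩, rfl⟩ := Submodule.mem_sup.mp hp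
    obtain ⟨q, hq, rfl⟩ := ih hs
    refine ⟨Fin.cons h q, Fin.cases hh hq, ?_⟩
    simp [Fin.sum_univ_succ, pow_succ', mul_assoc]

theorem almansiSpace_mono : Monotone almansiSpace := by
  refine monotone_nat_of_le_succ fun n => ?_
  induction n with
  | zero => exact bot_le
  | succ n ih => exact sup_le_sup_left (Submodule.map_mono ih) _

theorem normSq_mul_mem_almansiSpace {n : ℕ} {p : P2} (hp : p ∈ almansiSpace n) :
    X 0 * X 1 * p ∈ almansiSpace (n + 1) := by
  have h : (1 - X 0 * X 1 : P2) * p ∈ almansiSpace (n + 1) :=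
    Submodule.mem_sup_right ⟨p, hp, rfl⟩
  have := Submodule.sub_mem _ (almansiSpace_mono n.le_succ hp) h
  rwa [show p - (1 - X 0 * X 1 : P2) * p = X 0 * X 1 * p by ring] at this

theorem X_pow_mul_X_pow_mem_almansiSpace {n a b : ℕ} (h : min a b < n) :
    (X 0 ^ a * X 1 ^ b : P2) ∈ almansiSpace n := by
  induction n generalizing a b with
  | zero => simp at h
  | succ n ih =>
    rcases a with _ | a
    · refine Submodule.mem_sup_left ?_
      simp [Dz, Dzbar, Derivation.leibniz]
    rcases b with _ | b
    · refine Submodule.mem_sup_left ?_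
      simp [Dz, Dzbar]
    · have := normSq_mul_mem_almansiSpace (ih (a := a) (b := b) (by omega))
      rwa [show (X 0 * X 1 * (X 0 ^ a * X 1 ^ b) : P2) = X 0 ^ (a + 1) * X 1 ^ (b + 1) by
        ring] at this

theorem mem_almansiSpace_of_polyharmonic {n : ℕ} {p : P2} (hp : (Dz ^ n * Dzbar ^ n) p = 0) :
    p ∈ almansiSpace n := by
  rw [p.as_sum]
  refine Submodule.sum_mem _ fun m hm => ?_
  rw [monomial_eq, ← smul_eq_C_mul, Finsupp.prod_fintype _ _ (by simp), Fin.prod_univ_two]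
  refine Submodule.smul_mem _ _ (X_pow_mul_X_pow_mem_almansiSpace ?_)
  by_contra! hn
  obtain ⟨h0, h1⟩ := le_min_iff.mp hn
  refine mem_support_iff.mp hm ?_
  set r : Fin 2 →₀ ℕ := m - (Finsupp.single 0 n + Finsupp.single 1 n)
  have hr : m = r + Finsupp.single 0 n + Finsupp.single 1 n := by
    ext i
    fin_cases i <;> simp [r] <;> omega
  rw [hr]
  apply coeff_add_single_eq_zero_of_coeff_pderiv_pow
  apply coeff_add_single_eq_zero_of_coeff_pderiv_pow
  exact (congrArg (coeff r) hp).trans (coeff_zero r)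

/-- Almansi representation: a polynomial `p` with `∂ⁿ∂̄ⁿ p = 0`
(`n > 0`) is `q₀ + (1−|z|²) q₁ + … + (1−|z|²)^{n−1} q_{n−1}` with all `q_j`
harmonic. -/
theorem almansi_representation (n : ℕ) (hn : 0 < n) (p : P2)
    (hp : (Dz ^ n * Dzbar ^ n) p = 0) :
    ∃ q : Fin n → P2, (∀ j, (Dz * Dzbar) (q j) = 0) ∧
      p = ∑ j : Fin n, (1 - X 0 * X 1 : P2) ^ (j : ℕ) * q j :=
  exists_of_mem_almansiSpace (mem_almansiSpace_of_polyharmonic hp)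
end
end

section
/- Let n ∈ ℕ. (i) For every m ∈ ℕ, the polynomial e_{m,n}(z, z̄) = (1 − |z|²)^n z^m satisfies L_{n,−1} e_{m,n} = 0, and for every m ∈ ℕ with m > 0 the polynomial e_{−m,n}(z, z̄) = (1 − |z|²)^n z̄^m satisfies L_{−1,n} e_{−m,n} = 0. (ii) For every harmonic polynomial q ∈ ℂ[z, z̄] (∂ ∂̄ q = 0), the polynomial (1 − |z|²)^n q(z, z̄) is a finite ℂ-linear combination of the polynomials e_{m,n}(z, z̄), m ∈ ℤ. -/
open MvPolynomial

noncomputable section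

/-- `e_{m,n}(z, z̄) = (1 - z z̄)^n ξ_m(z)`. -/
def e (m : ℤ) (n : ℕ) : P2 := (1 - X 0 * X 1) ^ n * xi m

/-- The generalized harmonic operator
`L_{γ₁,γ₂} p = (1−|z|²)∂∂̄p + γ₁ z ∂p + γ₂ z̄ ∂̄p − γ₁γ₂ p`. -/
def Lop (γ₁ γ₂ : ℂ) (p : P2) : P2 :=
  (1 - X 0 * X 1) * (Dz (Dzbar p)) + γ₁ • ((X 0 : P2) * Dz p) +
    γ₂ • ((X 1 : P2) * Dzbar p) - (γ₁ * γ₂) • p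

theorem Dz_Dzbar_comm (p : P2) : Dz (Dzbar p) = Dzbar (Dz p) := by
  change pderiv 0 (pderiv 1 p) = pderiv 1 (pderiv 0 p)
  ext v
  simp only [coeff_pderiv, add_right_comm v (.single 0 1)]
  simp [mul_right_comm]

theorem Dz_mul (p q : P2) : Dz (p * q) = Dz p * q + p * Dz q := pderiv_mul

theorem Dzbar_mul (p q : P2) : Dzbar (p * q) = Dzbar p * q + p * Dzbar q := pderiv_mul

theorem Dz_one_sub : Dz (1 - X 0 * X 1) = -X 1 := by
  simp [Dz]

theorem Dzbar_one_sub : Dzbar (1 - X 0 * X 1) = -X 0 := by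
  simp [Dzbar]

theorem Dz_X_zero : Dz (X 0) = 1 := pderiv_X_self 0

theorem Dzbar_X_one : Dzbar (X 1) = 1 := pderiv_X_self 1

/-- A solution of the first-order equation `(1 - |z|²) ∂̄p = -c z p` is annihilated by
`L_{c,-1}`. -/
theorem Lop_neg_one_right_eq_zero {c : ℂ} {p : P2}
    (h : (1 - X 0 * X 1) * Dzbar p = -(c • (X 0 * p))) : Lop c (-1) p = 0 := by
  have h' := congrArg Dz h
  rw [Dz_mul, Dz_one_sub, map_neg, map_smul, Dz_mul, Dz_X_zero] at h'
  simp only [Lop, smul_eq_C_mul, map_neg, map_one, map_mul] at h' ⊢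
  linear_combination h'

/-- A solution of the first-order equation `(1 - |z|²) ∂p = -c z̄ p` is annihilated by
`L_{-1,c}`. -/
theorem Lop_neg_one_left_eq_zero {c : ℂ} {p : P2}
    (h : (1 - X 0 * X 1) * Dz p = -(c • (X 1 * p))) : Lop (-1) c p = 0 := by
  have h' := congrArg Dzbar h
  rw [Dzbar_mul, Dzbar_one_sub, map_neg, map_smul, Dzbar_mul, Dzbar_X_one,
    ← Dz_Dzbar_comm] at h'
  simp only [Lop, smul_eq_C_mul, map_neg, map_one, map_mul] at h' ⊢
  linear_combination h'

theorem mul_pderiv_pow (i : Fin 2) (w : P2) (n : ℕ) :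
    w * pderiv i (w ^ n) = (n : P2) * w ^ n * pderiv i w := by
  cases n with
  | zero => simp
  | succ n => rw [pderiv_pow, Nat.add_sub_cancel]; ring

theorem Dzbar_X_zero_pow (m : ℕ) : Dzbar (X 0 ^ m) = 0 := by
  simp [Dzbar]

theorem Dz_X_one_pow (m : ℕ) : Dz (X 1 ^ m) = 0 := by
  simp [Dz]

theorem xi_natCast (m : ℕ) : xi m = X 0 ^ m := by
  simp [xi]

theorem xi_neg_natCast {m : ℕ} (hm : 0 < m) : xi (-m) = X 1 ^ m := by
  simp [xi, hm.ne']

theorem Lop_e_natCast (n m : ℕ) : Lop n (-1) (e m n) = 0 := by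
  apply Lop_neg_one_right_eq_zero
  have h : (1 - X 0 * X 1) * Dzbar ((1 - X 0 * X 1) ^ n) =
      (n : P2) * (1 - X 0 * X 1) ^ n * Dzbar (1 - X 0 * X 1) := mul_pderiv_pow 1 _ n
  rw [Dzbar_one_sub] at h
  rw [e, xi_natCast, Dzbar_mul, Dzbar_X_zero_pow, Nat.cast_smul_eq_nsmul, nsmul_eq_mul]
  linear_combination X 0 ^ m * h

theorem Lop_e_neg_natCast (n : ℕ) {m : ℕ} (hm : 0 < m) : Lop (-1) n (e (-m) n) = 0 := by
  apply Lop_neg_one_left_eq_zero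
  have h : (1 - X 0 * X 1) * Dz ((1 - X 0 * X 1) ^ n) =
      (n : P2) * (1 - X 0 * X 1) ^ n * Dz (1 - X 0 * X 1) := mul_pderiv_pow 0 _ n
  rw [Dz_one_sub] at h
  rw [e, xi_neg_natCast hm, Dz_mul, Dz_X_one_pow, Nat.cast_smul_eq_nsmul, nsmul_eq_mul]
  linear_combination X 1 ^ m * h

theorem coeff_eq_zero_of_harmonic {q : P2} (hq : (Dz * Dzbar) q = 0) {v : Fin 2 →₀ ℕ}
    (h0 : v 0 ≠ 0) (h1 : v 1 ≠ 0) : coeff v q = 0 := by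
  have hv : v - .single 0 1 - .single 1 1 + .single 0 1 + .single 1 1 = v := by
    ext i
    fin_cases i <;> simp <;> omega
  have h : coeff (v - .single 0 1 - .single 1 1) (pderiv 0 (pderiv 1 q)) = 0 := by
    rw [show pderiv 0 (pderiv 1 q) = 0 from hq, coeff_zero]
  rw [coeff_pderiv, coeff_pderiv, hv] at h
  simpa [Nat.cast_add_one_ne_zero] using h

theorem monomial_eq_smul_xi {v : Fin 2 →₀ ℕ} (hv : v 0 = 0 ∨ v 1 = 0) (a : ℂ) :
    ∃ m : ℤ, (monomial v a : P2) = a • xi m := by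
  have key : (monomial v a : P2) = a • (X 0 ^ v 0 * X 1 ^ v 1) := by
    rw [monomial_eq, Finsupp.prod_fintype _ _ (by simp), Fin.prod_univ_two, C_mul']
  rcases eq_or_ne (v 1) 0 with h1 | h1
  · exact ⟨v 0, by rw [key, xi_natCast, h1, pow_zero, mul_one]⟩
  · exact ⟨-(v 1 : ℤ), by
      rw [key, xi_neg_natCast (Nat.pos_of_ne_zero h1), hv.resolve_right h1, pow_zero, one_mul]⟩

theorem mul_mem_span_e_of_harmonic (n : ℕ) {q : P2} (hq : (Dz * Dzbar) q = 0) :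
    (1 - X 0 * X 1 : P2) ^ n * q ∈ Submodule.span ℂ (Set.range fun m : ℤ => e m n) := by
  rw [q.as_sum, Finset.mul_sum]
  refine Submodule.sum_mem _ fun v hv => ?_
  have hv' : v 0 = 0 ∨ v 1 = 0 := by
    by_contra! h
    exact mem_support_iff.mp hv (coeff_eq_zero_of_harmonic hq h.1 h.2)
  obtain ⟨m, hm⟩ := monomial_eq_smul_xi hv' (coeff v q)
  rw [hm, mul_smul_comm]
  exact Submodule.smul_mem _ _ (Submodule.subset_span ⟨m, rfl⟩)

/-- (i) `L_{n,−1} e_{m,n} = 0` for `m ∈ ℕ` and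
`L_{−1,n} e_{−m,n} = 0` for `m > 0`; (ii) for every harmonic `q`,
`(1−|z|²)^n q` is a finite ℂ-linear combination of the `e_{m,n}`, `m ∈ ℤ`. -/
theorem e_are_generalized_harmonic (n : ℕ) :
    ((∀ m : ℕ, Lop (n : ℂ) (-1) (e (m : ℤ) n) = 0) ∧
      (∀ m : ℕ, 0 < m → Lop (-1) (n : ℂ) (e (-(m : ℤ)) n) = 0)) ∧
    (∀ q : P2, (Dz * Dzbar) q = 0 →
      (1 - X 0 * X 1 : P2) ^ n * q ∈
        Submodule.span ℂ (Set.range fun m : ℤ => e m n)) := by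
  exact ⟨⟨Lop_e_natCast n, fun _ => Lop_e_neg_natCast n⟩,
    fun _ => mul_mem_span_e_of_harmonic n⟩
end
end

section
/- Let γ₁ ∈ ℕ and γ₂ ∈ ℂ, and let N ≥ 1. Given c₁, …, c_N ∈ ℂ, consider the polynomial S_N(z, z̄) = ∑_{m=1}^{N} c_m F(−γ₁, m − γ₂, m + 1; |z|²) z^m, where F(−γ₁, b, c; x) = ∑_{k=0}^{γ₁} ((−γ₁)_k (b)_k / ((c)_k k!)) x^k. Then there exist harmonic polynomials q₀, …, q_{γ₁} ∈ ℂ[z, z̄] with q_j(0, z̄) = 0 for all j (each q_j is a ℂ-linear combination of z, z², z³, …), such that S_N(z, z̄) = q₀(z, z̄) + (1 − |z|²) q₁(z, z̄) + … + (1 − |z|²)^{γ₁} q_{γ₁}(z, z̄). In particular, ∂^{γ₁+1} ∂̄^{γ₁+1} S_N = 0. -/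
open MvPolynomial

noncomputable section

theorem Dzbar_monomial_zero (a : ℂ) (m : ℕ) : Dzbar (C a * X 0 ^ m : P2) = 0 := by
  simp [Dzbar]

theorem Dzbar_monomial_succ (a : ℂ) (m k : ℕ) :
    Dzbar (C a * X 0 ^ m * X 1 ^ (k + 1) : P2) = C (a * (k + 1)) * X 0 ^ m * X 1 ^ k := by
  simp [Dzbar]
  ring

theorem Dzbar_pow_monomial {n k : ℕ} (hk : k < n) (a : ℂ) (m : ℕ) :
    (Dzbar ^ n) (C a * X 0 ^ m * X 1 ^ k : P2) = 0 := by
  induction n generalizing k a with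
  | zero => simp at hk
  | succ n ih =>
    rw [pow_succ, Module.End.mul_apply]
    cases k with
    | zero => rw [pow_zero, mul_one, Dzbar_monomial_zero, map_zero]
    | succ k => rw [Dzbar_monomial_succ, ih (by omega)]

theorem Dzbar_eq_zero_of_mem_span {p : P2}
    (hp : p ∈ Submodule.span ℂ {p : P2 | ∃ i : ℕ, 1 ≤ i ∧ p = (X 0 : P2) ^ i}) :
    Dzbar p = 0 := by
  have h : Submodule.span ℂ {p : P2 | ∃ i : ℕ, 1 ≤ i ∧ p = (X 0 : P2) ^ i} ≤
      LinearMap.ker Dzbar := by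
    rw [Submodule.span_le]
    rintro _ ⟨i, -, rfl⟩
    simpa using Dzbar_monomial_zero 1 i
  exact h hp

/-- The expansion of `x ^ k` in powers of `1 - x`, padded with zero terms up to degree `n`. -/
theorem pow_eq_sum_one_sub_pow {R : Type*} [CommRing R] (x : R) {k n : ℕ} (hk : k ≤ n) :
    x ^ k = ∑ j ∈ Finset.range (n + 1), (1 - x) ^ j * ((-1) ^ j * (k.choose j : R)) := by
  have h : x ^ k = ∑ j ∈ Finset.range (k + 1), (1 - x) ^ j * ((-1) ^ j * (k.choose j : R)) := by
    conv_lhs => rw [show x = -(1 - x) + 1 by ring, add_pow]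
    refine Finset.sum_congr rfl fun j _ => ?_
    rw [neg_pow (1 - x) j]
    ring
  rw [h]
  refine Finset.sum_subset (Finset.range_mono (by omega)) fun j _ hj => ?_
  rw [Nat.choose_eq_zero_of_lt (by simpa using hj)]
  simp

/-- Only the shape of the sum matters for the decomposition: the coefficients are arbitrary. -/
theorem exists_decomposition (n : ℕ) (s : Finset ℕ) (hs : ∀ m ∈ s, 1 ≤ m) (c : ℕ → ℂ)
    (a : ℕ → ℕ → ℂ) :
    ∃ q : ℕ → P2,
      (∀ j, q j ∈ Submodule.span ℂ {p : P2 | ∃ i : ℕ, 1 ≤ i ∧ p = (X 0 : P2) ^ i}) ∧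
      ∑ m ∈ s, C (c m) * (∑ k ∈ Finset.range (n + 1), C (a m k) * (X 0 * X 1 : P2) ^ k) *
        (X 0 : P2) ^ m = ∑ j ∈ Finset.range (n + 1), (1 - X 0 * X 1 : P2) ^ j * q j := by
  refine ⟨fun j => ∑ m ∈ s, ∑ k ∈ Finset.range (n + 1),
    C (c m * a m k * ((-1) ^ j * (k.choose j : ℂ))) * X 0 ^ m, fun j => ?_, ?_⟩
  · refine Submodule.sum_mem _ fun m hm => Submodule.sum_mem _ fun k _ => ?_
    rw [← smul_eq_C_mul]
    exact Submodule.smul_mem _ _ (Submodule.subset_span ⟨m, hs m hm, rfl⟩)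
  · simp_rw [Finset.mul_sum, Finset.sum_mul]
    symm
    rw [Finset.sum_comm]
    refine Finset.sum_congr rfl fun m _ => ?_
    rw [Finset.sum_comm]
    refine Finset.sum_congr rfl fun k hk => ?_
    rw [pow_eq_sum_one_sub_pow (X 0 * X 1 : P2) (Nat.lt_succ_iff.mp (Finset.mem_range.mp hk))]
    simp_rw [Finset.mul_sum, Finset.sum_mul]
    refine Finset.sum_congr rfl fun j _ => ?_
    simp only [map_mul, map_pow, map_neg, map_one, map_natCast]
    ring

theorem Dzbar_pow_sum (n : ℕ) (s : Finset ℕ) (c : ℕ → ℂ) (a : ℕ → ℕ → ℂ) :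
    (Dzbar ^ (n + 1)) (∑ m ∈ s, C (c m) *
      (∑ k ∈ Finset.range (n + 1), C (a m k) * (X 0 * X 1 : P2) ^ k) * (X 0 : P2) ^ m) = 0 := by
  simp_rw [Finset.mul_sum, Finset.sum_mul, map_sum]
  refine Finset.sum_eq_zero fun m _ => Finset.sum_eq_zero fun k hk => ?_
  rw [← Dzbar_pow_monomial (Finset.mem_range.mp hk) (c m * a m k) (k + m), map_mul C]
  congr 1
  ring

/-- for `γ₁ ∈ ℕ`, `γ₂ ∈ ℂ`, the polynomial
`S_N = ∑_{m=1}^{N} c_m F(−γ₁, m−γ₂, m+1; |z|²) z^m` can be written as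
`q₀ + (1−|z|²) q₁ + … + (1−|z|²)^{γ₁} q_{γ₁}` with each `q_j` harmonic and a
ℂ-linear combination of `z, z², z³, …`; in particular `∂^{γ₁+1}∂̄^{γ₁+1} S_N = 0`. -/
theorem hypergeometric_sum_decomposition (γ₁ : ℕ) (γ₂ : ℂ) (N : ℕ) (hN : 1 ≤ N)
    (c : ℕ → ℂ) (S : P2)
    (hS : S = ∑ m ∈ Finset.Icc 1 N, C (c m) *
      (∑ k ∈ Finset.range (γ₁ + 1),
        C ((ascPochhammer ℂ k).eval (-(γ₁ : ℂ)) * (ascPochhammer ℂ k).eval ((m : ℂ) - γ₂) /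
            ((ascPochhammer ℂ k).eval ((m : ℂ) + 1) * (k.factorial : ℂ))) *
          (X 0 * X 1 : P2) ^ k) * (X 0 : P2) ^ m) :
    (∃ q : Fin (γ₁ + 1) → P2,
      (∀ j, (Dz * Dzbar) (q j) = 0 ∧
        q j ∈ Submodule.span ℂ {p : P2 | ∃ i : ℕ, 1 ≤ i ∧ p = (X 0 : P2) ^ i}) ∧
      S = ∑ j : Fin (γ₁ + 1), (1 - X 0 * X 1 : P2) ^ (j : ℕ) * q j) ∧
    (Dz ^ (γ₁ + 1) * Dzbar ^ (γ₁ + 1)) S = 0 := by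
  subst hS
  refine ⟨?_, ?_⟩
  · obtain ⟨q, hq, h⟩ := exists_decomposition γ₁ (Finset.Icc 1 N)
      (fun m hm => (Finset.mem_Icc.mp hm).1) c (fun m k =>
        (ascPochhammer ℂ k).eval (-(γ₁ : ℂ)) * (ascPochhammer ℂ k).eval ((m : ℂ) - γ₂) /
          ((ascPochhammer ℂ k).eval ((m : ℂ) + 1) * (k.factorial : ℂ)))
    refine ⟨fun j => q j, fun j => ⟨?_, hq j⟩, ?_⟩
    · rw [Module.End.mul_apply, Dzbar_eq_zero_of_mem_span (hq j), map_zero]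
    · rw [h, Finset.sum_range]
  · rw [Module.End.mul_apply, Dzbar_pow_sum, map_zero]
end
end

section
/- Let γ₁, γ₂ ∈ ℕ and let p ∈ ℂ[z, z̄] be a polynomial with L_{γ₁,γ₂} p = 0 (p is (γ₁,γ₂)-harmonic). Then p is polyharmonic of order max(γ₁ + 1, γ₂ + 1); that is, ∂^M ∂̄^M p = 0 where M = max(γ₁, γ₂) + 1. -/
open MvPolynomial

noncomputable section

theorem coeff_X_mul_pderiv {σ R : Type*} [CommSemiring R] (i : σ) (p : MvPolynomial σ R)
    (m : σ →₀ ℕ) : coeff m (X i * pderiv i p) = m i * coeff m p := by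
  classical
  induction p using MvPolynomial.induction_on' with
  | monomial u a =>
    rw [X_mul_pderiv_monomial, coeff_smul, coeff_monomial]
    split_ifs with h
    · simp [h]
    · simp
  | add p q hp hq => rw [map_add, mul_add, coeff_add, coeff_add, hp, hq, mul_add]

theorem exists_coeff_iterate_pderiv {σ R : Type*} [CommSemiring R] (i : σ) (k : ℕ)
    (p : MvPolynomial σ R) (m : σ →₀ ℕ) :
    ∃ c : R, coeff m ((pderiv i)^[k] p) = coeff (m + Finsupp.single i k) p * c := by
  induction k generalizing p with
  | zero => exact ⟨1, by simp⟩
  | succ k ih =>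
    obtain ⟨c, hc⟩ := ih (pderiv i p)
    rw [Function.iterate_succ_apply, hc, coeff_pderiv, add_assoc, ← Finsupp.single_add, mul_assoc]
    exact ⟨_, rfl⟩

theorem coeff_Lop (γ₁ γ₂ : ℂ) (p : P2) (m : Fin 2 →₀ ℕ) :
    coeff m (Lop γ₁ γ₂ p) =
      coeff (m + Finsupp.single 0 1 + Finsupp.single 1 1) p * (m 1 + 1) * (m 0 + 1) -
        (m 0 - γ₂) * (m 1 - γ₁) * coeff m p := by
  have hcomm : (X 0 * X 1 : P2) * pderiv 0 (pderiv 1 p) = X 0 * pderiv 0 (X 1 * pderiv 1 p) := by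
    rw [pderiv_mul, pderiv_X_of_ne (by decide)]
    ring
  simp only [Lop, Dz, Dzbar, Derivation.coeFn_coe, sub_mul, one_mul, hcomm, coeff_sub, coeff_add,
    coeff_smul, coeff_X_mul_pderiv, smul_eq_mul]
  rw [coeff_pderiv, coeff_pderiv]
  simp
  ring

/-- Coefficients of a `(γ₁,γ₂)`-harmonic polynomial vanish beyond the degrees `γ₂` in `z` and
`γ₁` in `z̄`: the harmonicity recursion would otherwise propagate a nonzero one forever along
the diagonal. -/
theorem coeff_eq_zero_of_Lop_eq_zero {γ₁ γ₂ : ℕ} {p : P2} (hp : Lop (γ₁ : ℂ) (γ₂ : ℂ) p = 0)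
    (m : Fin 2 →₀ ℕ) (h₀ : γ₂ < m 0) (h₁ : γ₁ < m 1) : coeff m p = 0 := by
  by_cases hm : p.totalDegree < m.degree
  · exact coeff_eq_zero_of_totalDegree_lt (by simpa [Finsupp.degree_apply] using hm)
  have hdeg : (m + Finsupp.single 0 1 + Finsupp.single 1 1).degree = m.degree + 2 := by
    simp [map_add, Finsupp.degree_single]
  have hnext : coeff (m + Finsupp.single 0 1 + Finsupp.single 1 1) p = 0 :=
    coeff_eq_zero_of_Lop_eq_zero hp _ (by simp; omega) (by simp; omega)
  have hrec := coeff_Lop γ₁ γ₂ p m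
  rw [hp, coeff_zero, hnext, zero_mul, zero_mul, zero_sub, eq_comm, neg_eq_zero] at hrec
  refine (mul_eq_zero.mp hrec).resolve_left (mul_ne_zero ?_ ?_)
  · exact sub_ne_zero.mpr (by exact_mod_cast h₀.ne')
  · exact sub_ne_zero.mpr (by exact_mod_cast h₁.ne')
termination_by p.totalDegree + 1 - m.degree

/-- a `(γ₁,γ₂)`-harmonic polynomial with `γ₁, γ₂ ∈ ℕ` is
polyharmonic of order `max(γ₁, γ₂) + 1`. -/
theorem gammaHarmonic_polyharmonic (γ₁ γ₂ : ℕ) (p : P2)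
    (hp : Lop (γ₁ : ℂ) (γ₂ : ℂ) p = 0) :
    (Dz ^ (max γ₁ γ₂ + 1) * Dzbar ^ (max γ₁ γ₂ + 1)) p = 0 := by
  ext m
  rw [Module.End.mul_apply, Module.End.pow_apply, Module.End.pow_apply, coeff_zero]
  obtain ⟨c, hc⟩ := exists_coeff_iterate_pderiv 0 (max γ₁ γ₂ + 1)
    ((pderiv 1)^[max γ₁ γ₂ + 1] p) m
  obtain ⟨d, hd⟩ := exists_coeff_iterate_pderiv 1 (max γ₁ γ₂ + 1) p
    (m + Finsupp.single 0 (max γ₁ γ₂ + 1))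
  refine hc.trans ?_
  rw [hd, coeff_eq_zero_of_Lop_eq_zero hp _ (by simp; omega) (by simp; omega), zero_mul, zero_mul]
end
end

section
/- Let m, n ∈ ℕ. For 0 ≤ l ≤ n define the polynomials O_l^{m,n}(x) = (1 − x)^l · o_l^{m,n}(x) ∈ ℂ[x], where o_l^{m,n}(x) = ∑_{j=0}^{n−l} ((−n+l)_j (m−n+l)_j / ((m+1)_j j!)) x^j. Then O_0^{m,n}, O_1^{m,n}, …, O_n^{m,n} form a ℂ-basis of the (n+1)-dimensional space of polynomials in ℂ[x] of degree at most n. -/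
noncomputable section

/-- The hypergeometric polynomial
`o_l^{m,n}(x) = ∑_{j=0}^{n−l} ((−n+l)_j (m−n+l)_j / ((m+1)_j j!)) x^j`. -/
def opoly (m n l : ℕ) : Polynomial ℂ :=
  ∑ j ∈ Finset.range (n - l + 1),
    Polynomial.C ((ascPochhammer ℂ j).eval (-(n : ℂ) + l) *
        (ascPochhammer ℂ j).eval ((m : ℂ) - n + l) /
        ((ascPochhammer ℂ j).eval ((m : ℂ) + 1) * (j.factorial : ℂ))) *
      Polynomial.X ^ j

/-- `O_l^{m,n}(x) = (1 − x)^l o_l^{m,n}(x)`. -/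
def Opoly (m n l : ℕ) : Polynomial ℂ := (1 - Polynomial.X) ^ l * opoly m n l

open Polynomial in
/-- The Chu–Vandermonde identity `₂F₁(-N, b; c; 1) (c)_N = (c - b)_N`, cleared of denominators. -/
lemma sum_choose_mul_ascPochhammer {R : Type*} [CommRing R] (N : ℕ) (b c : R) :
    ∑ ij ∈ Finset.HasAntidiagonal.antidiagonal N, (N.choose ij.1 : R) *
        ((-1) ^ ij.1 * (ascPochhammer R ij.1).eval b * (ascPochhammer R ij.2).eval (c + ij.1)) =
      (ascPochhammer R N).eval (c - b) := by
  induction N generalizing b c with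
  | zero => simp
  | succ N ih =>
    rw [Finset.sum_antidiagonal_choose_succ_mul (fun i k => (-1) ^ i *
      (ascPochhammer R i).eval b * (ascPochhammer R k).eval (c + i))]
    have h₁ : ∑ ij ∈ Finset.HasAntidiagonal.antidiagonal N, (N.choose ij.1 : R) * ((-1) ^ ij.1 *
        (ascPochhammer R ij.1).eval b * (ascPochhammer R (ij.2 + 1)).eval (c + ij.1)) =
        (c + N) * (ascPochhammer R N).eval (c - b) := by
      rw [← ih, Finset.mul_sum]
      refine Finset.sum_congr rfl fun ij hij => ?_
      rw [← Finset.HasAntidiagonal.mem_antidiagonal.mp hij, ascPochhammer_succ_eval]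
      push_cast
      ring
    have h₂ : ∑ ij ∈ Finset.HasAntidiagonal.antidiagonal N, (N.choose ij.2 : R) * ((-1) ^ (ij.1 + 1) *
        (ascPochhammer R (ij.1 + 1)).eval b *
          (ascPochhammer R ij.2).eval (c + ((ij.1 + 1 : ℕ) : R))) =
        -b * (ascPochhammer R N).eval (c - b) := by
      rw [← add_sub_add_right_eq_sub c b 1, ← ih, Finset.mul_sum]
      refine Finset.sum_congr rfl fun ij hij => ?_
      rw [Nat.choose_symm_of_eq_add ((Finset.HasAntidiagonal.mem_antidiagonal.mp hij).symm.trans (add_comm _ _)),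
        ascPochhammer_succ_left, eval_mul, eval_X, eval_comp, eval_add, eval_X, eval_one]
      push_cast
      rw [show c + (ij.1 + 1) = c + 1 + (ij.1 : R) by ring]
      ring
    rw [h₁, h₂, ascPochhammer_succ_eval]
    ring

lemma ascPochhammer_eval_natCast_add_one_ne_zero (k j : ℕ) :
    (ascPochhammer ℂ j).eval ((k : ℂ) + 1) ≠ 0 := by
  rw [← Nat.cast_add_one, ← ascPochhammer_eval_cast, Nat.cast_ne_zero]
  exact (ascPochhammer_pos j (k + 1) k.succ_pos).ne'

lemma opoly_eval_one_ne_zero (m : ℕ) {n l : ℕ} (hl : l ≤ n) : (opoly m n l).eval 1 ≠ 0 := by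
  obtain ⟨N, rfl⟩ := Nat.exists_eq_add_of_le hl
  have key : (opoly m (l + N) l).eval 1 * (ascPochhammer ℂ N).eval ((m : ℂ) + 1) =
      (ascPochhammer ℂ N).eval ((N : ℂ) + 1) := by
    rw [show (N : ℂ) + 1 = (m : ℂ) + 1 - (m - N) by ring, ← sum_choose_mul_ascPochhammer,
      Finset.Nat.sum_antidiagonal_eq_sum_range_succ_mk, opoly, Nat.add_sub_cancel_left,
      Polynomial.eval_finsetSum, Finset.sum_mul]
    refine Finset.sum_congr rfl fun j hj => ?_
    have hjN : j + (N - j) = N := Nat.add_sub_cancel' (Finset.mem_range_succ_iff.mp hj)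
    have hsplit : (ascPochhammer ℂ N).eval ((m : ℂ) + 1) =
        (ascPochhammer ℂ j).eval ((m : ℂ) + 1) *
          (ascPochhammer ℂ (N - j)).eval ((m : ℂ) + 1 + j) := by
      conv_lhs => rw [← hjN, ← ascPochhammer_mul]
      simp
    have hneg : (ascPochhammer ℂ j).eval (-(N : ℂ)) =
        (-1) ^ j * ((j.factorial : ℂ) * N.choose j) := by
      rw [ascPochhammer_eval_neg_eq_descPochhammer, descPochhammer_eval_eq_descFactorial,
        Nat.descFactorial_eq_factorial_mul_choose, Nat.cast_mul]
    have h₁ := ascPochhammer_eval_natCast_add_one_ne_zero m j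
    have h₂ : (j.factorial : ℂ) ≠ 0 := Nat.cast_ne_zero.mpr j.factorial_ne_zero
    rw [hsplit, show -((l + N : ℕ) : ℂ) + l = -N by push_cast; ring,
      show (m : ℂ) - (l + N : ℕ) + l = m - N by push_cast; ring, hneg]
    simp only [Polynomial.eval_mul, Polynomial.eval_C, Polynomial.eval_pow, Polynomial.eval_X,
      one_pow, mul_one]
    field_simp
  exact left_ne_zero_of_mul (key ▸ ascPochhammer_eval_natCast_add_one_ne_zero N N)

lemma Opoly_mem_degreeLE (m : ℕ) {n l : ℕ} (hl : l ≤ n) :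
    Opoly m n l ∈ Polynomial.degreeLE ℂ (n : WithBot ℕ) := by
  rw [Polynomial.mem_degreeLE, ← Polynomial.natDegree_le_iff_degree_le, Opoly,
    ← Nat.add_sub_cancel' hl]
  refine Polynomial.natDegree_mul_le_of_le ?_ ?_
  · simpa using Polynomial.natDegree_pow_le_of_le l
      (Polynomial.natDegree_sub_le_of_le (m := 1) (n := 1) (p := (1 : Polynomial ℂ))
        (q := Polynomial.X) (by simp) (by simp))
  · rw [Nat.add_sub_cancel' hl]
    refine Polynomial.natDegree_sum_le_of_forall_le _ _ fun j hj => ?_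
    exact (Polynomial.natDegree_C_mul_X_pow_le _ _).trans (Finset.mem_range_succ_iff.mp hj)

/-- A family `(1 - X) ^ l * p l` whose cofactors `p l` do not vanish at `1` is linearly
independent, because its members have pairwise distinct orders of vanishing at `1`. -/
lemma linearIndependent_one_sub_X_pow_mul {K : Type*} [Field K] {N : ℕ}
    (p : Fin N → Polynomial K) (hp : ∀ l, (p l).eval 1 ≠ 0) :
    LinearIndependent K fun l : Fin N => (1 - Polynomial.X) ^ (l : ℕ) * p l := by
  have htaylor (l : Fin N) : Polynomial.taylor 1 ((1 - Polynomial.X) ^ (l : ℕ) * p l) =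
      Polynomial.C ((-1) ^ (l : ℕ)) * Polynomial.taylor 1 (p l) * Polynomial.X ^ (l : ℕ) := by
    rw [Polynomial.taylor_mul, Polynomial.taylor_pow, map_sub, Polynomial.taylor_one,
      Polynomial.taylor_X, Polynomial.C_1, sub_add_cancel_right, neg_pow]
    simp only [Polynomial.C_pow, Polynomial.C_neg, Polynomial.C_1]
    ring
  rw [Fintype.linearIndependent_iff]
  intro g hg k
  induction k using WellFoundedLT.induction with
  | _ k ih =>
    have hk := congrArg (fun q => (Polynomial.taylor 1 q).coeff k) hg
    simp only [map_sum, map_smul, Polynomial.finsetSum_coeff, Polynomial.coeff_smul, htaylor,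
      map_zero, Polynomial.coeff_zero] at hk
    rw [Finset.sum_eq_single k] at hk
    · rw [Polynomial.coeff_mul_X_pow', if_pos le_rfl, Nat.sub_self, Polynomial.coeff_C_mul,
        Polynomial.taylor_coeff_zero, smul_eq_mul] at hk
      exact (mul_eq_zero.mp hk).resolve_right (mul_ne_zero (by simp) (hp k))
    · intro l _ hlk
      rcases lt_or_gt_of_ne hlk with h | h
      · rw [ih l h, zero_smul]
      · rw [Polynomial.coeff_mul_X_pow', if_neg (by simpa using h), smul_zero]
    · simp

/-- `O_0^{m,n}, …, O_n^{m,n}` form a ℂ-basis of the space of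
polynomials of degree at most `n`: they are linearly independent and span
`degreeLE ℂ n`. -/
theorem Opoly_basis (m n : ℕ) :
    LinearIndependent ℂ (fun l : Fin (n + 1) => Opoly m n (l : ℕ)) ∧
    Submodule.span ℂ (Set.range fun l : Fin (n + 1) => Opoly m n (l : ℕ)) =
      Polynomial.degreeLE ℂ (n : WithBot ℕ) := by
  have hli : LinearIndependent ℂ (fun l : Fin (n + 1) => Opoly m n (l : ℕ)) :=
    linearIndependent_one_sub_X_pow_mul (fun l : Fin (n + 1) => opoly m n l)
      fun l => opoly_eval_one_ne_zero m l.is_le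
  refine ⟨hli, ?_⟩
  rw [← Polynomial.degreeLT_succ_eq_degreeLE]
  refine Submodule.eq_of_le_of_finrank_eq (Submodule.span_le.mpr ?_) ?_
  · rintro _ ⟨l, rfl⟩
    rw [Polynomial.degreeLT_succ_eq_degreeLE]
    exact Opoly_mem_degreeLE m l.is_le
  · rw [finrank_span_eq_card hli, Module.finrank_eq_card_basis (Polynomial.degreeLT.basis ℂ (n + 1))]
end
end
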